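/- Let T:Ω×ℝ^d→Ω×ℝ^d be a random C¹-map with ergodic base (Ω,F,P,θ), and let K⊆Ω×ℝ^d be a T-invariant random compact set. Suppose that for all k∈ℕ and all ε>0 there is r>0 such that sup{log‖DT^k_ω(x)‖ : ω∈Ω, x∈B_r(K(ω))} ≤ sup{log‖DT^k_ω(x)‖ : ω∈Ω, x∈K(ω)} + ε, and that λ(μ,T)<0 for all μ∈M_P^K(T). Then there exists an integer n such that #K(ω)=n for P-a.e. ω∈Ω. -/

import Mathlib

open MeasureTheory Metric Filter

/-- Iterated fibre maps: `fiter θ F n ω = F_{θ^{n-1}ω} ∘ ⋯ ∘ F_ω`. -/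
noncomputable def fiter {Ω M : Type*} (θ : Ω → Ω) (F : Ω → M → M) : ℕ → Ω → M → M
  | 0 => fun _ x => x
  | n + 1 => fun ω x => F (θ^[n] ω) (fiter θ F n ω x)


theorem aux_hilbert {H : Type*} [NormedAddCommGroup H] [InnerProductSpace ℂ H]
    (S : ℕ → Set H) (hanti : Antitone S) (hne : ∀ m, (S m).Nonempty) (B : ℝ)
    (hB : ∀ m, ∀ x ∈ S m, ‖x‖ ≤ B)
    (hmid : ∀ m, ∀ x ∈ S m, ∀ y ∈ S m, (1 / 2 : ℂ) • (x + y) ∈ S m) :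
    ∃ x : ℕ → H, (∀ m, x m ∈ S m) ∧ CauchySeq x := by
  set a : ℕ → ℝ := fun m => sInf ((fun x => ‖x‖ ^ 2) '' S m) with ha
  have hbdd : ∀ m, BddBelow ((fun x : H => ‖x‖ ^ 2) '' S m) := by
    intro m
    refine ⟨0, ?_⟩
    rintro _ ⟨x, -, rfl⟩
    positivity
  have hale : ∀ m, ∀ x ∈ S m, a m ≤ ‖x‖ ^ 2 := fun m x hx => csInf_le (hbdd m) ⟨x, hx, rfl⟩
  have hmono : Monotone a := by
    intro m n hmn
    exact csInf_le_csInf (hbdd m) ((hne n).image _) (Set.image_mono (hanti hmn))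
  have haB : ∀ m, a m ≤ B ^ 2 := by
    intro m
    obtain ⟨x, hx⟩ := hne m
    have := hB m x hx
    exact (hale m x hx).trans (by gcongr)
  have hlim : Tendsto a atTop (nhds (⨆ m, a m)) :=
    tendsto_atTop_ciSup hmono ⟨B ^ 2, by rintro _ ⟨m, rfl⟩; exact haB m⟩
  set A := ⨆ m, a m
  have haA : ∀ m, a m ≤ A := fun m => le_ciSup (f := a) ⟨B ^ 2, by rintro _ ⟨m, rfl⟩; exact haB m⟩ m
  have hx : ∀ m : ℕ, ∃ x ∈ S m, ‖x‖ ^ 2 < a m + 1 / ((m : ℝ) + 1) := by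
    intro m
    obtain ⟨_, ⟨x, hx, rfl⟩, h⟩ := exists_lt_of_csInf_lt ((hne m).image (fun x => ‖x‖ ^ 2))
      (show sInf ((fun x => ‖x‖ ^ 2) '' S m) < a m + 1 / ((m : ℝ) + 1) by
        have : 0 < 1 / ((m : ℝ) + 1) := by positivity
        simp only [ha]; linarith)
    exact ⟨x, hx, h⟩
  choose x hxS hxa using hx
  refine ⟨x, hxS, ?_⟩
  set b : ℕ → ℝ := fun N => Real.sqrt (2 * (A - a N) + 4 * (1 / ((N : ℝ) + 1)))
  have key : ∀ N n m : ℕ, N ≤ n → n ≤ m → dist (x n) (x m) ≤ b N := by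
    intro N n m hNn hnm
    rw [dist_eq_norm]
    apply Real.le_sqrt_of_sq_le
    have h1 := hale n _ (hmid n (x n) (hxS n) (x m) (hanti hnm (hxS m)))
    have h2 := parallelogram_law_with_norm ℂ (x n) (x m)
    rw [norm_smul] at h1
    have h3 : ‖(1 / 2 : ℂ)‖ = 1 / 2 := by simp
    rw [h3] at h1
    have h4 := hxa n
    have h5 := hxa m
    have h6 := haA m
    have h7 := hmono hNn
    have e1 : 1 / ((n : ℝ) + 1) ≤ 1 / ((N : ℝ) + 1) := by gcongr
    have e2 : 1 / ((m : ℝ) + 1) ≤ 1 / ((N : ℝ) + 1) := by gcongr; exact hNn.trans hnm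
    nlinarith
  refine cauchySeq_of_le_tendsto_0 b ?_ ?_
  · intro n m N hn hm
    rcases le_total n m with h | h
    · exact key N n m hn h
    · rw [dist_comm]; exact key N m n hm h
  · have : Tendsto (fun N : ℕ => 2 * (A - a N) + 4 * (1 / ((N : ℝ) + 1))) atTop
        (nhds (2 * (A - A) + 4 * 0)) :=
      ((tendsto_const_nhds.sub hlim).const_mul 2).add
        (tendsto_one_div_add_atTop_nhds_zero_nat.const_mul 4)
    have h := this.sqrt
    simp only [sub_self, mul_zero, add_zero, Real.sqrt_zero] at h
    exact h

/-- maximal ergodic lemma -/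
theorem aux_maximal {Ω : Type*} [MeasurableSpace Ω] (P : Measure Ω) [IsProbabilityMeasure P]
    (τ : Ω → Ω) (hτ : MeasurePreserving τ P P) (f : Ω → ℝ) (hf : Measurable f)
    (B : ℝ) (hB : ∀ ω, |f ω| ≤ B) (hneg : ∫ ω, f ω ∂P < 0) :
    P {ω | ∀ n : ℕ, ∑ j ∈ Finset.range n, f (τ^[j] ω) ≤ 0} ≠ 0 := by
  intro h0
  -- M n = max (0, S_1, ..., S_n)
  let M : ℕ → Ω → ℝ := fun n => Nat.rec (fun _ => 0) (fun _ g ω => max 0 (f ω + g (τ ω))) n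
  have hM0 : ∀ ω, M 0 ω = 0 := fun _ => rfl
  have hMs : ∀ n ω, M (n + 1) ω = max 0 (f ω + M n (τ ω)) := fun _ _ => rfl
  have hMm : ∀ n, Measurable (M n) := by
    intro n
    induction n with
    | zero => exact measurable_const
    | succ n ih => exact measurable_const.max (hf.add (ih.comp hτ.measurable))
  have hMn : ∀ n ω, 0 ≤ M n ω := by
    intro n ω
    cases n with
    | zero => simp [hM0]
    | succ n => rw [hMs]; exact le_max_left _ _
  have hMmono : ∀ n ω, M n ω ≤ M (n + 1) ω := by
    intro n
    induction n with
    | zero => intro ω; rw [hM0]; exact hMn (0 + 1) ω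
    | succ n ih => intro ω; rw [hMs, hMs (n + 1)]; gcongr; exact ih _
  have hMB : ∀ n ω, M n ω ≤ n * |B| := by
    intro n
    induction n with
    | zero => intro ω; simp [hM0]
    | succ n ih =>
      intro ω
      rw [hMs]
      have h1 := ih (τ ω)
      have h2 := (le_abs_self _).trans ((hB ω).trans (le_abs_self B))
      push_cast
      apply max_le
      · positivity
      · linarith
  have hMS : ∀ n ω, ∑ j ∈ Finset.range n, f (τ^[j] ω) ≤ M n ω := by
    intro n
    induction n with
    | zero => intro ω; simp [hM0]
    | succ n ih =>
      intro ω
      rw [Finset.sum_range_succ', hMs]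
      have := ih (τ ω)
      refine le_trans ?_ (le_max_right _ _)
      simp only [Function.iterate_succ, Function.comp, Function.iterate_zero, id]
      linarith
  have hMint : ∀ n, Integrable (M n) P := by
    intro n
    refine Integrable.of_bound (hMm n).aestronglyMeasurable (n * |B|) (ae_of_all _ fun ω => ?_)
    rw [Real.norm_of_nonneg (hMn n ω)]
    exact hMB n ω
  have hfint : Integrable f P :=
    Integrable.of_bound hf.aestronglyMeasurable B (ae_of_all _ hB)
  -- key inequality
  have hkey : ∀ n, 0 ≤ ∫ ω, Set.indicator {ω | 0 < M n ω} f ω ∂P := by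
    intro n
    have hle : ∀ ω, M n ω - M n (τ ω) ≤ Set.indicator {ω | 0 < M n ω} f ω := by
      intro ω
      rcases Classical.em (ω ∈ {ω | 0 < M n ω}) with h | h
      · rw [Set.indicator_of_mem h]
        rw [Set.mem_setOf_eq] at h
        have h1 := hMmono n ω
        rw [hMs] at h1
        rcases max_cases 0 (f ω + M n (τ ω)) with ⟨h2, _⟩ | ⟨h2, _⟩
        · rw [h2] at h1; linarith
        · rw [h2] at h1; linarith
      · rw [Set.indicator_of_notMem h]
        rw [Set.mem_setOf_eq] at h
        have := hMn n (τ ω)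
        have := hMn n ω
        push Not at h
        linarith
    have hi2 : Integrable (fun ω => M n (τ ω)) P := hτ.integrable_comp_of_integrable (hMint n)
    have hEq : ∫ ω, M n (τ ω) ∂P = ∫ ω, M n ω ∂P := by
      have := integral_map hτ.measurable.aemeasurable (f := M n) (μ := P)
        (by rw [hτ.map_eq]; exact (hMm n).aestronglyMeasurable)
      rw [hτ.map_eq] at this
      exact this.symm
    have : ∫ ω, (M n ω - M n (τ ω)) ∂P = 0 := by
      rw [integral_sub (hMint n) hi2, hEq, sub_self]
    refine this.symm.le.trans ?_
    refine integral_mono ((hMint n).sub hi2) (hfint.indicator (measurableSet_lt measurable_const (hMm n))) hle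
  have hlim : Tendsto (fun n => ∫ ω, Set.indicator {ω | 0 < M n ω} f ω ∂P) atTop
      (nhds (∫ ω, f ω ∂P)) := by
    refine tendsto_integral_of_dominated_convergence (fun _ => B)
      (fun n => (hf.indicator (measurableSet_lt measurable_const (hMm n))).aestronglyMeasurable)
      (integrable_const _) ?_ ?_
    · intro n
      refine ae_of_all _ fun ω => ?_
      refine (norm_indicator_le_norm_self _ _).trans (hB ω)
    · have : ∀ᵐ ω ∂P, ¬ (∀ n : ℕ, ∑ j ∈ Finset.range n, f (τ^[j] ω) ≤ 0) :=
        measure_eq_zero_iff_ae_notMem.mp h0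
      filter_upwards [this] with ω hω
      push Not at hω
      obtain ⟨n, hn⟩ := hω
      refine tendsto_atTop_of_eventually_const (i₀ := n) fun i hi => ?_
      rw [Set.indicator_of_mem]
      have : M n ω ≤ M i ω := monotone_nat_of_le_succ (f := fun n => M n ω) (fun n => hMmono n ω) hi
      exact lt_of_lt_of_le hn ((hMS n ω).trans this)
  have := ge_of_tendsto' hlim hkey
  linarith

theorem aux_subadd (a : ℕ → ℕ → ℝ) (C : ℝ) (hC : 0 ≤ C) (m k n : ℕ) (hn : n ≤ m)
    (hsub : ∀ i j l, i ≤ j → j ≤ l → l ≤ k + m → a i l ≤ a i j + a j l)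
    (hbd : ∀ i j, i ≤ j → j ≤ k + m → a i j ≤ C * (j - i : ℝ)) :
    n * a 0 (k + m) - 2 * C * m * m ≤ ∑ j ∈ Finset.range k, a j (j + n) := by
  have h1 : ∀ q ≤ k, ∑ i ∈ Finset.range n, a 0 (q + i) ≤
      ∑ i ∈ Finset.range n, a 0 i + ∑ j ∈ Finset.range q, a j (j + n) := by
    intro q
    induction q with
    | zero => intro _; simp
    | succ q ih =>
      intro hq
      have h2 := ih (by omega)
      have h3 := hsub 0 q (q + n) (by omega) (by omega) (by omega)
      have h4 : ∑ i ∈ Finset.range n, a 0 (q + 1 + i) =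
          ∑ i ∈ Finset.range n, a 0 (q + i) + a 0 (q + n) - a 0 q := by
        have e1 := Finset.sum_range_succ (fun i => a 0 (q + i)) n
        have e2 := Finset.sum_range_succ' (fun i => a 0 (q + i)) n
        simp only [add_zero] at e2
        have e3 : ∑ i ∈ Finset.range n, a 0 (q + 1 + i) = ∑ i ∈ Finset.range n, a 0 (q + (i + 1)) := by
          refine Finset.sum_congr rfl fun i _ => ?_
          congr 1; omega
        rw [e3]; linarith
      rw [Finset.sum_range_succ, h4]
      linarith
  have h2 := h1 k le_rfl
  have hmn : (n : ℝ) ≤ m := by exact_mod_cast hn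
  have h3 : ∑ i ∈ Finset.range n, a 0 i ≤ ∑ i ∈ Finset.range n, C * (m : ℝ) := by
    refine Finset.sum_le_sum fun i hi => ?_
    have hi' := Finset.mem_range.mp hi
    have := hbd 0 i (by omega) (by omega)
    have h5 : (i : ℝ) ≤ m := by exact_mod_cast (by omega : i ≤ m)
    refine this.trans ?_
    push_cast
    gcongr
    linarith
  have h4 : ∑ i ∈ Finset.range n, (a 0 (k + m) - C * m) ≤ ∑ i ∈ Finset.range n, a 0 (k + i) := by
    refine Finset.sum_le_sum fun i hi => ?_
    have hi' := Finset.mem_range.mp hi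
    have g1 := hsub 0 (k + i) (k + m) (by omega) (by omega) (by omega)
    have g2 := hbd (k + i) (k + m) (by omega) (by omega)
    have g3 : C * (((k + m : ℕ) : ℝ) - ((k + i : ℕ) : ℝ)) ≤ C * m := by
      push_cast
      gcongr
      have : (0 : ℝ) ≤ i := by positivity
      linarith
    linarith
  simp only [Finset.sum_const, Finset.card_range, nsmul_eq_mul] at h3 h4
  have h6 : (n : ℝ) * (C * m) ≤ C * m * m := by
    have : 0 ≤ C * m := by positivity
    nlinarith
  nlinarith

theorem aux_weak_limit {E : Type*} [NormedAddCommGroup E] [InnerProductSpace ℝ E]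
    [FiniteDimensional ℝ E] [MeasurableSpace E] [BorelSpace E]
    (q : ℕ → E) (hq : DenseRange q) (ν : ℕ → ProbabilityMeasure E)
    (C : Set E) (hC : IsCompact C) (hsupp : ∀ m, (ν m : Measure E) Cᶜ = 0)
    (z : ℕ → ℂ)
    (hconv : ∀ i, Tendsto (fun m => charFun (ν m : Measure E) (q i)) atTop (nhds (z i))) :
    ∃ ν0 : ProbabilityMeasure E, Tendsto ν atTop (nhds ν0) := by
  have hcomp : IsCompact {μ : ProbabilityMeasure E | ∀ n : ℕ, μ ((fun _ : ℕ => C) n)ᶜ ≤ (fun _ : ℕ => (0 : NNReal)) n} :=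
    isCompact_setOfPred_probabilityMeasure_mass_eq_compl_isCompact_le tendsto_const_nhds
      (fun _ => hC) (Or.inr (fun _ _ _ => le_rfl))
  have hmem : ∀ m, ν m ∈ {μ : ProbabilityMeasure E | ∀ n : ℕ, μ ((fun _ : ℕ => C) n)ᶜ ≤ (fun _ : ℕ => (0 : NNReal)) n} := by
    intro m n
    have := hsupp m
    simp only [nonpos_iff_eq_zero]
    exact (ProbabilityMeasure.null_iff_toMeasure_null (ν m) Cᶜ).mpr this
  have hcont : ∀ t : E, Continuous (fun μ : ProbabilityMeasure E => charFun (μ : Measure E) t) := by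
    intro t
    rw [continuous_iff_continuousAt]
    intro μ
    have h := (ProbabilityMeasure.tendsto_iff_forall_integral_rclike_tendsto ℂ).mp
      (tendsto_id (α := ProbabilityMeasure E) (x := nhds μ)) (BoundedContinuousFunction.innerProbChar t)
    simp_rw [ContinuousAt, charFun_eq_integral_innerProbChar]
    exact h
  have hclus : ∀ μ : ProbabilityMeasure E, MapClusterPt μ atTop ν →
      ∀ i, charFun (μ : Measure E) (q i) = z i := by
    intro μ hμ i
    have h1 := hμ.continuousAt_comp (hcont (q i)).continuousAt
    have h2 := hconv i
    have h3 : ClusterPt (charFun (μ : Measure E) (q i)) (nhds (z i)) := h1.clusterPt.mono h2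
    exact eq_of_nhds_neBot h3
  obtain ⟨ν0, hν0, hcl⟩ := hcomp.exists_mapClusterPt (f := atTop) (u := ν)
    (Filter.le_principal_iff.mpr (Filter.mem_map.mpr (Filter.univ_mem' hmem)))
  refine ⟨ν0, hcomp.tendsto_nhds_of_unique_mapClusterPt (Eventually.of_forall hmem) ?_⟩
  intro μ _ hμ
  haveI := μ.2
  haveI := ν0.2
  have hme : (μ : Measure E) = (ν0 : Measure E) := by
    apply Measure.ext_of_charFun
    refine DenseRange.equalizer hq continuous_charFun continuous_charFun ?_
    funext i
    simp only [Function.comp]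
    rw [hclus μ hμ i, hclus ν0 hcl i]
  exact Subtype.ext hme

noncomputable def auxPM {E : Type*} [MeasurableSpace E] (μ : Measure E) [h : IsProbabilityMeasure μ] :
    ProbabilityMeasure E := ⟨μ, h⟩

theorem aux_limit_kernel {Ω E : Type*} [MeasurableSpace Ω] [NormedAddCommGroup E]
    [InnerProductSpace ℝ E] [FiniteDimensional ℝ E] [MeasurableSpace E] [BorelSpace E]
    (P : Measure Ω) (κ : ℕ → ProbabilityTheory.Kernel Ω E)
    [hM : ∀ m, ProbabilityTheory.IsMarkovKernel (κ m)]
    (h : ∀ᵐ ω ∂P, ∃ ν0 : ProbabilityMeasure E,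
      Tendsto (fun m => auxPM (κ m ω)) atTop (nhds ν0)) :
    ∃ κ0 : ProbabilityTheory.Kernel Ω E, ProbabilityTheory.IsMarkovKernel κ0 ∧
      ∀ᵐ ω ∂P, ∀ f : BoundedContinuousFunction E ℝ,
        Tendsto (fun m => ∫ x, f x ∂(κ m ω)) atTop (nhds (∫ x, f x ∂(κ0 ω))) := by
  classical
  obtain ⟨G, hGs, hGm, hGP⟩ := exists_measurable_superset_of_null (ae_iff.mp h)
  have hlim : ∀ ω, ω ∉ G → ∃ ν0 : ProbabilityMeasure E,
      Tendsto (fun m => auxPM (κ m ω)) atTop (nhds ν0) := by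
    intro ω hω
    by_contra hc
    exact hω (hGs hc)
  let κ' : ℕ → Ω → ProbabilityMeasure E := fun m ω =>
    if ω ∈ G then auxPM (Measure.dirac 0) else auxPM (κ m ω)
  have hlim' : ∀ ω, ∃ ν0 : ProbabilityMeasure E, Tendsto (fun m => κ' m ω) atTop (nhds ν0) := by
    intro ω
    by_cases hω : ω ∈ G
    · simp only [κ', hω, if_true]
      exact ⟨_, tendsto_const_nhds⟩
    · simp only [κ', hω, if_false]
      exact hlim ω hω
  choose ν hν using hlim'
  have hκ'm : ∀ m, Measurable (fun ω => (κ' m ω : Measure E)) := by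
    intro m
    have : (fun ω => (κ' m ω : Measure E)) = fun ω => if ω ∈ G then Measure.dirac 0 else κ m ω := by
      funext ω
      by_cases hω : ω ∈ G
      · simp only [κ', hω, if_true]; rfl
      · simp only [κ', hω, if_false]; rfl
    rw [this]
    exact Measurable.ite hGm measurable_const (κ m).measurable
  have hmeas : Measurable (fun ω => (ν ω : Measure E)) := by
    refine Measurable.measure_of_isPiSystem_of_isProbabilityMeasure
      (S := {s : Set E | IsClosed s}) ?_ isPiSystem_isClosed ?_
    · rw [BorelSpace.measurable_eq (α := E), borel_eq_generateFrom_isClosed]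
    · intro s hs
      have hs : IsClosed s := hs
      refine measurable_of_tendsto_metrizable (f := fun n ω => ∫⁻ x, hs.apprSeq n x ∂(ν ω : Measure E)) ?_ ?_
      · intro n
        refine measurable_of_tendsto_metrizable (f := fun m ω => ∫⁻ x, hs.apprSeq n x ∂(κ' m ω : Measure E)) ?_ ?_
        · intro m
          refine (Measure.measurable_lintegral ?_).comp (hκ'm m)
          exact (hs.apprSeq n).continuous.measurable.coe_nnreal_ennreal
        · rw [tendsto_pi_nhds]
          intro ω
          exact ProbabilityMeasure.tendsto_iff_forall_lintegral_tendsto.mp (hν ω) (hs.apprSeq n)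
      · rw [tendsto_pi_nhds]
        intro ω
        exact HasOuterApproxClosed.tendsto_lintegral_apprSeq hs _
  refine ⟨⟨fun ω => (ν ω : Measure E), hmeas⟩, ⟨fun ω => ?_⟩, ?_⟩
  · exact (ν ω).2
  · have hG : ∀ᵐ ω ∂P, ω ∉ G := measure_eq_zero_iff_ae_notMem.mp hGP
    filter_upwards [hG] with ω hω f
    have h1 := ProbabilityMeasure.tendsto_iff_forall_integral_tendsto.mp (hν ω) f
    simp only [κ', hω, if_false] at h1
    exact h1

theorem aux_compact {Ω E : Type*} [MeasurableSpace Ω] [NormedAddCommGroup E]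
    [InnerProductSpace ℝ E] [FiniteDimensional ℝ E] [MeasurableSpace E] [BorelSpace E]
    (P : Measure Ω) [IsProbabilityMeasure P] (D : ℕ → Set (Measure (Ω × E)))
    (hanti : Antitone D) (hne : ∀ m, (D m).Nonempty)
    (hprob : ∀ μ ∈ D 0, IsProbabilityMeasure μ) (hfst : ∀ μ ∈ D 0, μ.fst = P)
    (hmid : ∀ m, ∀ μ ∈ D m, ∀ ν ∈ D m, (2⁻¹ : ENNReal) • (μ + ν) ∈ D m)
    (C : Ω → Set E) (hC : ∀ ω, IsCompact (C ω))
    (hsupp : ∀ μ ∈ D 0, ∀ᵐ p ∂μ, p.2 ∈ C p.1) :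
    ∃ μs : ℕ → Measure (Ω × E), (∀ j, μs j ∈ D j) ∧ ∃ μ : Measure (Ω × E),
      IsProbabilityMeasure μ ∧ μ.fst = P ∧
      ∀ f : Ω × E → ℝ, Measurable f → (∀ ω, Continuous fun x => f (ω, x)) →
        (∃ B, ∀ p, |f p| ≤ B) →
        Tendsto (fun j => ∫ p, f p ∂(μs j)) atTop (nhds (∫ p, f p ∂μ)) := by
  let w : Measure ℕ := (Measure.count : Measure ℕ).toFinite
  have hw : ∀ p : ℕ → Prop, (∀ᵐ i ∂w, p i) → ∀ i, p i := by
    intro p hp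
    have hp' : ∀ᵐ i ∂(Measure.count : Measure ℕ), p i := by
      have h := ae_toFinite (μ := (Measure.count : Measure ℕ))
      rw [← h]; exact hp
    simpa using Measure.ae_count_iff.mp hp'
  set q : ℕ → E := TopologicalSpace.denseSeq E with hqdef
  have hq : DenseRange q := TopologicalSpace.denseRange_denseSeq E
  let U : ProbabilityTheory.Kernel Ω E → Ω × ℕ → ℂ := fun κ p => charFun (κ p.1) (q p.2)
  have hUm : ∀ κ : ProbabilityTheory.Kernel Ω E, ∀ _ : ProbabilityTheory.IsMarkovKernel κ,
      Measurable (U κ) := by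
    intro κ _
    refine measurable_from_prod_countable_left fun i => ?_
    simp only [U, charFun_eq_integral_innerProbChar]
    exact (StronglyMeasurable.integral_kernel
      (BoundedContinuousFunction.innerProbChar (q i)).continuous.stronglyMeasurable).measurable
  have hUb : ∀ κ : ProbabilityTheory.Kernel Ω E, ∀ _ : ProbabilityTheory.IsMarkovKernel κ,
      ∀ p, ‖U κ p‖ ≤ 1 := fun κ _ p => norm_charFun_le_one _
  have hUL : ∀ κ : ProbabilityTheory.Kernel Ω E, ∀ _ : ProbabilityTheory.IsMarkovKernel κ,
      MemLp (U κ) 2 (P.prod w) := fun κ hκ =>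
    MemLp.of_bound (hUm κ hκ).aestronglyMeasurable 1 (ae_of_all _ (hUb κ hκ))
  let S : ℕ → Set (Lp ℂ 2 (P.prod w)) := fun m =>
    {x | ∃ κ : ProbabilityTheory.Kernel Ω E, ProbabilityTheory.IsMarkovKernel κ ∧
      Measure.compProd P κ ∈ D m ∧ x =ᵐ[P.prod w] U κ}
  have hD0 : ∀ m, D m ⊆ D 0 := fun m => hanti (Nat.zero_le m)
  obtain ⟨x, hxS, hxC⟩ := aux_hilbert S (by
      rintro m n hmn x ⟨κ, h1, h2, h3⟩
      exact ⟨κ, h1, hanti hmn h2, h3⟩) (by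
      intro m
      obtain ⟨μ, hμ⟩ := hne m
      have := hprob μ (hD0 m hμ)
      have h1 := hfst μ (hD0 m hμ)
      refine ⟨(hUL μ.condKernel inferInstance).toLp _, μ.condKernel, inferInstance, ?_, MemLp.coeFn_toLp _⟩
      have h2 := μ.disintegrate μ.condKernel
      rw [h1] at h2
      rw [h2]; exact hμ) (((P.prod w).real Set.univ) ^ ((2 : ENNReal).toReal⁻¹) * 1) (by
      rintro m x ⟨κ, h1, h2, h3⟩
      have := Lp.norm_le_of_ae_bound (f := x) (C := 1) (by norm_num) (by
        filter_upwards [h3] with p hp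
        rw [hp]; exact hUb κ h1 p)
      exact_mod_cast this) (by
      rintro m x ⟨κ, h1, h2, h3⟩ y ⟨κ', h1', h2', h3'⟩
      let η : ProbabilityTheory.Kernel Ω E :=
        ⟨fun ω => (2⁻¹ : ENNReal) • (κ ω + κ' ω), by
          refine Measure.measurable_of_measurable_coe _ fun s hs => ?_
          simp only [Measure.smul_apply, Measure.add_apply, smul_eq_mul]
          exact ((κ.measurable_coe hs).add (κ'.measurable_coe hs)).const_mul _⟩
      have hηa : ∀ ω, η ω = (2⁻¹ : ENNReal) • (κ ω + κ' ω) := fun ω => rfl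
      have hη : ProbabilityTheory.IsMarkovKernel η := ⟨fun ω => ⟨by
        rw [hηa]
        simp only [Measure.smul_apply, Measure.add_apply, smul_eq_mul, measure_univ]
        rw [one_add_one_eq_two]
        exact ENNReal.inv_mul_cancel (by simp) (by simp)⟩⟩
      refine ⟨η, hη, ?_, ?_⟩
      · have : Measure.compProd P η = (2⁻¹ : ENNReal) • (Measure.compProd P κ + Measure.compProd P κ') := by
          ext s hs
          rw [Measure.compProd_apply hs]
          simp only [Measure.smul_apply, Measure.add_apply, smul_eq_mul, hηa]
          have hm1 : Measurable fun a => κ a (Prod.mk a ⁻¹' s) :=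
            ProbabilityTheory.Kernel.measurable_kernel_prodMk_left hs
          have hm2 : Measurable fun a => κ' a (Prod.mk a ⁻¹' s) :=
            ProbabilityTheory.Kernel.measurable_kernel_prodMk_left hs
          have hm3 : Measurable fun a => κ a (Prod.mk a ⁻¹' s) + κ' a (Prod.mk a ⁻¹' s) :=
            hm1.add hm2
          rw [lintegral_const_mul _ hm3, lintegral_add_left hm1,
            Measure.compProd_apply hs, Measure.compProd_apply hs]
        rw [this]
        exact hmid m _ h2 _ h2'
      · filter_upwards [h3, h3', Lp.coeFn_smul (1 / 2 : ℂ) (x + y), Lp.coeFn_add x y]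
          with p hp hp' hs ha
        rw [hs, Pi.smul_apply, ha, Pi.add_apply, hp, hp']
        simp only [U, charFun_eq_integral_innerProbChar, hηa]
        rw [integral_smul_measure, integral_add_measure
          (BoundedContinuousFunction.integrable _ _) (BoundedContinuousFunction.integrable _ _)]
        simp
        ring)
  choose κ hκM hκD hκU using hxS
  obtain ⟨xl, hxl⟩ := cauchySeq_tendsto_of_complete hxC
  obtain ⟨ns, hns, hae⟩ := (tendstoInMeasure_of_tendsto_Lp hxl).exists_seq_tendsto_ae
  have hsm := hns.id_le
  have h1 : ∀ᵐ p ∂(P.prod w), Tendsto (fun j => U (κ (ns j)) p) atTop (nhds (xl p)) := by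
    have hall : ∀ᵐ p ∂(P.prod w), ∀ j, x j p = U (κ j) p := ae_all_iff.mpr hκU
    filter_upwards [hae, hall] with p hp hp'
    simpa only [hp'] using hp
  have h2 := Measure.ae_ae_of_ae_prod h1
  have h3 : ∀ᵐ ω ∂P, ∀ j, ∀ᵐ y ∂(κ j ω), y ∈ C ω := by
    rw [ae_all_iff]
    intro j
    exact Measure.ae_ae_of_ae_compProd (hsupp _ (hD0 j (hκD j)))
  obtain ⟨κ0, hκ0, hconv⟩ := aux_limit_kernel P (fun j => κ (ns j)) (by
    filter_upwards [h2, h3] with ω hω hω'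
    refine aux_weak_limit q hq _ (C ω) (hC ω) (fun j => ?_) (fun i => xl (ω, i)) ?_
    · exact ae_iff.mp (hω' (ns j))
    · exact hw _ hω)
  refine ⟨fun j => Measure.compProd P (κ (ns j)), fun j => hanti (hsm j) (hκD _),
    Measure.compProd P κ0, inferInstance, Measure.fst_compProd _ _, ?_⟩
  rintro f hf hfc ⟨B, hB⟩
  have hint : ∀ μ : Measure (Ω × E), IsProbabilityMeasure μ → Integrable f μ := fun μ _ =>
    Integrable.of_bound hf.aestronglyMeasurable B (ae_of_all _ hB)
  have hev : ∀ η : ProbabilityTheory.Kernel Ω E, ProbabilityTheory.IsMarkovKernel η →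
      ∫ p, f p ∂(Measure.compProd P η) = ∫ ω, ∫ y, f (ω, y) ∂(η ω) ∂P := fun η _ =>
    Measure.integral_compProd (hint _ inferInstance)
  rw [hev κ0 hκ0]
  have : (fun j => ∫ p, f p ∂(Measure.compProd P (κ (ns j)))) =
      fun j => ∫ ω, ∫ y, f (ω, y) ∂(κ (ns j) ω) ∂P := by
    funext j; exact hev _ (hκM _)
  rw [this]
  refine tendsto_integral_of_dominated_convergence (fun _ => B) ?_ (integrable_const _) ?_ ?_
  · intro j
    exact (hf.stronglyMeasurable.integral_kernel_prod_right').aestronglyMeasurable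
  · intro j
    refine ae_of_all _ fun ω => ?_
    have := norm_integral_le_of_norm_le_const (μ := κ (ns j) ω) (f := fun y => f (ω, y)) (C := B)
      (ae_of_all _ fun y => hB (ω, y))
    simpa using this
  · filter_upwards [hconv] with ω hω
    exact hω (BoundedContinuousFunction.ofNormedAddCommGroup (fun x => f (ω, x)) (hfc ω) B
      (fun x => hB (ω, x)))

theorem fiter_add' {Ω M : Type*} (θ : Ω → Ω) (F : Ω → M → M) (m n : ℕ) (ω : Ω) (x : M) :
    fiter θ F (m + n) ω x = fiter θ F m (θ^[n] ω) (fiter θ F n ω x) := by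
  induction m with
  | zero => simp [fiter]
  | succ m ih =>
    rw [show m + 1 + n = (m + n) + 1 by omega]
    simp only [fiter, ih, Function.iterate_add_apply]

theorem fiter_iter {Ω M : Type*} (θ : Ω → Ω) (F : Ω → M → M) (n : ℕ) (p : Ω × M) :
    (fun p : Ω × M => (θ p.1, F p.1 p.2))^[n] p = (θ^[n] p.1, fiter θ F n p.1 p.2) := by
  induction n with
  | zero => simp [fiter]
  | succ n ih => rw [Function.iterate_succ_apply', ih]; simp only [fiter, Function.iterate_succ_apply']

theorem aux_opnorm_sup {E : Type*} [NormedAddCommGroup E] [NormedSpace ℝ E]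
    (q : ℕ → E) (hq : DenseRange q) (A : E →L[ℝ] E) : ‖A‖ = ⨆ i, ‖A (q i)‖ / ‖q i‖ := by
  have hb : BddAbove (Set.range fun i => ‖A (q i)‖ / ‖q i‖) :=
    ⟨‖A‖, by rintro _ ⟨i, rfl⟩; exact A.ratio_le_opNorm (q i)⟩
  apply le_antisymm
  · refine A.opNorm_le_bound (Real.iSup_nonneg fun i => by positivity) fun v => ?_
    have hcl : IsClosed {v : E | ‖A v‖ ≤ (⨆ i, ‖A (q i)‖ / ‖q i‖) * ‖v‖} :=
      isClosed_le (by fun_prop) (by fun_prop)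
    refine hq.induction_on (p := fun v => ‖A v‖ ≤ (⨆ i, ‖A (q i)‖ / ‖q i‖) * ‖v‖) v hcl ?_
    intro i
    rcases eq_or_ne (q i) 0 with h | h
    · simp [h]
    · have h1 := le_ciSup hb i
      have h2 : 0 < ‖q i‖ := norm_pos_iff.mpr h
      exact (div_le_iff₀ h2).mp h1
  · exact ciSup_le fun i => A.ratio_le_opNorm (q i)

theorem aux_fderiv_apply_meas {Ω E : Type*} [MeasurableSpace Ω] [NormedAddCommGroup E]
    [InnerProductSpace ℝ E] [FiniteDimensional ℝ E] [MeasurableSpace E] [BorelSpace E]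
    (G : Ω → E → E) (hG : ∀ ω, ContDiff ℝ 1 (G ω)) (hGm : ∀ x, Measurable fun ω => G ω x)
    (x v : E) : Measurable fun ω => fderiv ℝ (G ω) x v := by
  refine measurable_of_tendsto_metrizable
      (f := fun (n : ℕ) ω => (n : ℝ) • (G ω (x + (n : ℝ)⁻¹ • v) - G ω x)) ?_ ?_
  · intro n
    exact ((hGm _).sub (hGm _)).const_smul _
  · rw [tendsto_pi_nhds]
    intro ω
    have hd : HasFDerivAt (G ω) (fderiv ℝ (G ω) x) x :=
      ((hG ω).differentiable one_ne_zero x).hasFDerivAt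
    exact hd.lim v (c := fun n : ℕ => (n : ℝ)) (l := atTop) (by
      simpa using tendsto_natCast_atTop_atTop)

theorem aux_fderiv_meas {Ω E : Type*} [MeasurableSpace Ω] [NormedAddCommGroup E]
    [InnerProductSpace ℝ E] [FiniteDimensional ℝ E] [MeasurableSpace E] [BorelSpace E]
    (G : Ω → E → E) (hG : ∀ ω, ContDiff ℝ 1 (G ω)) (hGm : ∀ x, Measurable fun ω => G ω x) :
    Measurable fun p : Ω × E => ‖fderiv ℝ (G p.1) p.2‖ := by
  have hc : ∀ ω, Continuous fun x => ‖fderiv ℝ (G ω) x‖ := fun ω =>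
    ((hG ω).continuous_fderiv one_ne_zero).norm
  have hm : ∀ x, Measurable fun ω => ‖fderiv ℝ (G ω) x‖ := by
    intro x
    have h1 : (fun ω => ‖fderiv ℝ (G ω) x‖) = fun ω => ⨆ i,
        ‖fderiv ℝ (G ω) x (TopologicalSpace.denseSeq E i)‖ / ‖TopologicalSpace.denseSeq E i‖ := by
      funext ω
      exact aux_opnorm_sup _ (TopologicalSpace.denseRange_denseSeq E) _
    rw [h1]
    refine Measurable.iSup fun i => ?_
    exact (aux_fderiv_apply_meas G hG hGm x _).norm.div_const _
  have h3 := measurable_uncurry_of_continuous_of_measurable (u := fun x ω => ‖fderiv ℝ (G ω) x‖) hc hm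
  have h4 : Measurable (fun p : Ω × E => (p.2, p.1)) := measurable_snd.prodMk measurable_fst
  have h5 := Measurable.comp h3 h4
  simpa only [Function.comp_def, Function.uncurry] using h5

set_option linter.unusedSectionVars false
section
variable {Ω E : Type*} [MeasurableSpace Ω] [NormedAddCommGroup E]
    [InnerProductSpace ℝ E] [FiniteDimensional ℝ E] [MeasurableSpace E] [BorelSpace E]

theorem fiter_contDiff (θ : Ω → Ω) (F : Ω → E → E) (hF : ∀ ω, ContDiff ℝ 1 (F ω)) (n : ℕ) (ω : Ω) :
    ContDiff ℝ 1 (fiter θ F n ω) := by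
  induction n with
  | zero => exact contDiff_id
  | succ n ih => exact (hF _).comp ih

theorem joint_meas (F : Ω → E → E) (hF : ∀ ω, Continuous (F ω))
    (hFm : ∀ x, Measurable fun ω => F ω x) : Measurable fun p : Ω × E => F p.1 p.2 := by
  have := measurable_uncurry_of_continuous_of_measurable (u := fun x ω => F ω x) hF hFm
  exact this.comp measurable_swap

theorem T_meas (θ : Ω → Ω) (hθ : Measurable θ) (F : Ω → E → E) (hF : ∀ ω, ContDiff ℝ 1 (F ω))
    (hFm : ∀ x, Measurable fun ω => F ω x) :
    Measurable (fun p : Ω × E => (θ p.1, F p.1 p.2)) :=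
  (hθ.comp measurable_fst).prodMk (joint_meas F (fun ω => (hF ω).continuous) hFm)

theorem fiter_meas (θ : Ω → Ω) (hθ : Measurable θ) (F : Ω → E → E) (hF : ∀ ω, ContDiff ℝ 1 (F ω))
    (hFm : ∀ x, Measurable fun ω => F ω x) (n : ℕ) :
    Measurable fun p : Ω × E => fiter θ F n p.1 p.2 := by
  have h := (T_meas θ hθ F hF hFm).iterate n
  have h2 : (fun p : Ω × E => fiter θ F n p.1 p.2) =
      fun p => ((fun p : Ω × E => (θ p.1, F p.1 p.2))^[n] p).2 := by
    funext p; rw [fiter_iter]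
  rw [h2]
  exact measurable_snd.comp h

theorem fiter_chain (θ : Ω → Ω) (F : Ω → E → E) (hF : ∀ ω, ContDiff ℝ 1 (F ω)) (m n : ℕ)
    (ω : Ω) (x : E) :
    ‖fderiv ℝ (fiter θ F (m + n) ω) x‖ ≤
      ‖fderiv ℝ (fiter θ F m (θ^[n] ω)) (fiter θ F n ω x)‖ * ‖fderiv ℝ (fiter θ F n ω) x‖ := by
  have h1 : fiter θ F (m + n) ω = fiter θ F m (θ^[n] ω) ∘ fiter θ F n ω := by
    funext y; exact fiter_add' θ F m n ω y
  rw [h1, fderiv_comp x ((fiter_contDiff θ F hF m _).differentiable one_ne_zero _)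
    ((fiter_contDiff θ F hF n _).differentiable one_ne_zero _)]
  exact ContinuousLinearMap.opNorm_comp_le _ _

/-- truncated log-derivative -/
noncomputable def gF (θ : Ω → Ω) (F : Ω → E → E) (C N : ℝ) (n : ℕ) (p : Ω × E) : ℝ :=
  min (C * n) (Real.log (max ‖fderiv ℝ (fiter θ F n p.1) p.2‖ (Real.exp (-(N * n)))))

theorem gF_meas (θ : Ω → Ω) (hθ : Measurable θ) (F : Ω → E → E) (hF : ∀ ω, ContDiff ℝ 1 (F ω))
    (hFm : ∀ x, Measurable fun ω => F ω x) (C N : ℝ) (n : ℕ) : Measurable (gF θ F C N n) := by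
  unfold gF
  have h := aux_fderiv_meas (fiter θ F n) (fiter_contDiff θ F hF n)
    (fun x => (fiter_meas θ hθ F hF hFm n).comp (measurable_id.prodMk measurable_const))
  exact measurable_const.min (Real.measurable_log.comp (h.max measurable_const))

theorem gF_cont (θ : Ω → Ω) (F : Ω → E → E) (hF : ∀ ω, ContDiff ℝ 1 (F ω))
    (C N : ℝ) (n : ℕ) (ω : Ω) : Continuous fun x => gF θ F C N n (ω, x) := by
  unfold gF
  refine continuous_const.min (Continuous.log ?_ ?_)
  · exact (((fiter_contDiff θ F hF n ω).continuous_fderiv one_ne_zero).norm).max continuous_const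
  · intro x
    exact (lt_of_lt_of_le (Real.exp_pos _) (le_max_right _ _)).ne'

theorem gF_le (θ : Ω → Ω) (F : Ω → E → E) (C N : ℝ) (n : ℕ) (p : Ω × E) :
    gF θ F C N n p ≤ C * n := min_le_left _ _

theorem le_gF (θ : Ω → Ω) (F : Ω → E → E) (C N : ℝ) (hC : 0 ≤ C) (hN : 0 ≤ N) (n : ℕ) (p : Ω × E) :
    -(N * n) ≤ gF θ F C N n p := by
  unfold gF
  refine le_min ?_ ?_
  · have : 0 ≤ C * n := by positivity
    have : 0 ≤ N * n := by positivity
    linarith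
  · rw [Real.le_log_iff_exp_le (lt_of_lt_of_le (Real.exp_pos _) (le_max_right _ _))]
    exact le_max_right _ _

theorem gF_bound (θ : Ω → Ω) (F : Ω → E → E) (C N : ℝ) (hC : 0 ≤ C) (hN : 0 ≤ N) (n : ℕ)
    (p : Ω × E) : |gF θ F C N n p| ≤ (C + N) * n := by
  have h1 := gF_le θ F C N n p
  have h2 := le_gF θ F C N hC hN n p
  have : 0 ≤ C * n := by positivity
  have : 0 ≤ N * n := by positivity
  rw [abs_le]; constructor <;> linarith

theorem exp_gF (θ : Ω → Ω) (F : Ω → E → E) (C N : ℝ) (hC : 0 ≤ C) (hN : 0 ≤ N) (n : ℕ) (p : Ω × E)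
    (h : ‖fderiv ℝ (fiter θ F n p.1) p.2‖ ≤ Real.exp (C * n)) :
    Real.exp (gF θ F C N n p) = max ‖fderiv ℝ (fiter θ F n p.1) p.2‖ (Real.exp (-(N * n))) := by
  have hpos := lt_of_lt_of_le (Real.exp_pos (-(N * n)))
    (le_max_right ‖fderiv ℝ (fiter θ F n p.1) p.2‖ (Real.exp (-(N * n))))
  have : 0 ≤ C * n := by positivity
  have : 0 ≤ N * n := by positivity
  unfold gF
  rw [min_eq_right, Real.exp_log hpos]
  rw [Real.log_le_iff_le_exp hpos]
  exact max_le h (Real.exp_le_exp.mpr (by linarith))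

theorem gF_subadd (θ : Ω → Ω) (F : Ω → E → E) (hF : ∀ ω, ContDiff ℝ 1 (F ω))
    (C N : ℝ) (hC : 0 ≤ C) (hN : 0 ≤ N) (m n : ℕ) (ω : Ω) (x : E)
    (h1 : ‖fderiv ℝ (fiter θ F m (θ^[n] ω)) (fiter θ F n ω x)‖ ≤ Real.exp (C * m))
    (h2 : ‖fderiv ℝ (fiter θ F n ω) x‖ ≤ Real.exp (C * n)) :
    gF θ F C N (n + m) (ω, x) ≤ gF θ F C N n (ω, x) + gF θ F C N m (θ^[n] ω, fiter θ F n ω x) := by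
  have hch := fiter_chain θ F hF m n ω x
  rw [add_comm m n] at hch
  have h3 : ‖fderiv ℝ (fiter θ F (n + m) ω) x‖ ≤ Real.exp (C * (n + m : ℕ)) := by
    refine hch.trans ((mul_le_mul h1 h2 (norm_nonneg _) (Real.exp_pos _).le).trans ?_)
    rw [← Real.exp_add]
    apply Real.exp_le_exp.mpr
    push_cast; linarith
  rw [← Real.exp_le_exp, Real.exp_add, exp_gF θ F C N hC hN _ (ω, x) h3,
    exp_gF θ F C N hC hN _ (ω, x) h2, exp_gF θ F C N hC hN _ (θ^[n] ω, fiter θ F n ω x) h1]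
  apply max_le
  · refine hch.trans ?_
    rw [mul_comm]
    exact mul_le_mul (le_max_left _ _) (le_max_left _ _) (norm_nonneg _)
      ((norm_nonneg _).trans (le_max_left _ _))
  · have : Real.exp (-(N * (n + m : ℕ))) = Real.exp (-(N * n)) * Real.exp (-(N * m)) := by
      rw [← Real.exp_add]; congr 1; push_cast; ring
    rw [this]
    exact mul_le_mul (le_max_right _ _) (le_max_right _ _) (Real.exp_pos _).le
      ((Real.exp_pos _).le.trans (le_max_right _ _))

theorem near_step (G : E → E) (hG : ContDiff ℝ 1 G) (A B : Set E) (hA : IsCompact A)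
    (hAne : A.Nonempty) (hAB : G '' A = B) (r L : ℝ)
    (hL : ∀ x, infDist x A < r → ‖fderiv ℝ G x‖ ≤ L) (hL0 : 0 ≤ L) (x : E) (hx : infDist x A < r) :
    infDist (G x) B ≤ L * infDist x A := by
  obtain ⟨p, hp, hpe⟩ := hA.exists_infDist_eq_dist hAne x
  have hb : ∀ y ∈ ball p r, ‖fderiv ℝ G y‖ ≤ L := fun y hy =>
    hL y ((infDist_le_dist_of_mem hp).trans_lt hy)
  have hr : 0 < r := infDist_nonneg.trans_lt hx
  have := (convex_ball p r).norm_image_sub_le_of_norm_fderiv_le (f := G) (x := p) (y := x) (𝕜 := ℝ)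
    (fun y _ => hG.differentiable one_ne_zero y) hb (mem_ball_self hr) (by rw [mem_ball, ← hpe]; exact hx)
  have h2 : infDist (G x) B ≤ dist (G x) (G p) :=
    infDist_le_dist_of_mem (hAB ▸ Set.mem_image_of_mem G hp)
  rw [dist_eq_norm] at h2
  rw [hpe, dist_eq_norm]
  exact h2.trans this

/-- good base point -/
def Good (θ : Ω → Ω) (F : Ω → E → E) (Kf : Ω → Set E) (ω : Ω) : Prop :=
  ∀ n, (Kf (θ^[n] ω)).Nonempty ∧ F (θ^[n] ω) '' Kf (θ^[n] ω) = Kf (θ^[n + 1] ω)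

theorem Good.iter {θ : Ω → Ω} {F : Ω → E → E} {Kf : Ω → Set E} {ω : Ω} (h : Good θ F Kf ω) (j : ℕ) :
    Good θ F Kf (θ^[j] ω) := by
  intro n
  have := h (n + j)
  simp only [← Function.iterate_add_apply]
  rw [show n + 1 + j = n + j + 1 by omega]
  exact this

theorem Good.image {θ : Ω → Ω} {F : Ω → E → E} {Kf : Ω → Set E} {ω : Ω} (h : Good θ F Kf ω) (j : ℕ) :
    fiter θ F j ω '' Kf ω = Kf (θ^[j] ω) := by
  induction j with
  | zero => simp [fiter]
  | succ j ih =>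
    rw [← (h j).2, ← ih, Set.image_image]
    rfl

theorem near_iter (θ : Ω → Ω) (F : Ω → E → E) (hF : ∀ ω, ContDiff ℝ 1 (F ω)) (Kf : Ω → Set E)
    (hK : ∀ ω, IsCompact (Kf ω)) (r C : ℝ) (hC : 0 ≤ C)
    (hL : ∀ ω x, infDist x (Kf ω) < r → ‖fderiv ℝ (F ω) x‖ ≤ Real.exp C)
    (ω : Ω) (hω : Good θ F Kf ω) (x : E) (k : ℕ) (hx : infDist x (Kf ω) * Real.exp (C * k) < r)
    (j : ℕ) (hj : j ≤ k) :
    infDist (fiter θ F j ω x) (Kf (θ^[j] ω)) ≤ infDist x (Kf ω) * Real.exp (C * j) ∧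
    infDist (fiter θ F j ω x) (Kf (θ^[j] ω)) < r := by
  have key : ∀ j ≤ k, infDist x (Kf ω) * Real.exp (C * j) < r := by
    intro j hj
    refine lt_of_le_of_lt ?_ hx
    refine mul_le_mul_of_nonneg_left (Real.exp_le_exp.mpr ?_) infDist_nonneg
    exact mul_le_mul_of_nonneg_left (by exact_mod_cast hj) hC
  have main : ∀ j ≤ k, infDist (fiter θ F j ω x) (Kf (θ^[j] ω)) ≤ infDist x (Kf ω) * Real.exp (C * j) := by
    intro j
    induction j with
    | zero => intro _; simp [fiter]
    | succ j ih =>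
      intro hj
      have h1 := ih (by omega)
      have h2 := near_step (F (θ^[j] ω)) (hF _) _ _ (hK _) (hω j).1 (hω j).2 r (Real.exp C)
        (hL _) (Real.exp_pos _).le _ (h1.trans_lt (key j (by omega)))
      refine h2.trans ?_
      calc Real.exp C * infDist (fiter θ F j ω x) (Kf (θ^[j] ω))
          ≤ Real.exp C * (infDist x (Kf ω) * Real.exp (C * j)) :=
            mul_le_mul_of_nonneg_left h1 (Real.exp_pos _).le
        _ = infDist x (Kf ω) * Real.exp (C * (j + 1 : ℕ)) := by
            push_cast; rw [mul_add, Real.exp_add, mul_one]; ring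
  exact ⟨main j hj, (main j hj).trans_lt (key j hj)⟩

theorem near_fderiv (θ : Ω → Ω) (F : Ω → E → E) (hF : ∀ ω, ContDiff ℝ 1 (F ω)) (Kf : Ω → Set E)
    (hK : ∀ ω, IsCompact (Kf ω)) (r C : ℝ) (hC : 0 ≤ C)
    (hL : ∀ ω x, infDist x (Kf ω) < r → ‖fderiv ℝ (F ω) x‖ ≤ Real.exp C)
    (ω : Ω) (hω : Good θ F Kf ω) (x : E) (k : ℕ) (hx : infDist x (Kf ω) * Real.exp (C * k) < r)
    (i n : ℕ) (hj : i + n ≤ k) :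
    ‖fderiv ℝ (fiter θ F n (θ^[i] ω)) (fiter θ F i ω x)‖ ≤ Real.exp (C * n) := by
  induction n with
  | zero =>
    have : fiter θ F 0 (θ^[i] ω) = (id : E → E) := rfl
    rw [this, fderiv_id]
    simpa using ContinuousLinearMap.norm_id_le
  | succ n ih =>
    have h0 := ih (by omega)
    have h1 := fiter_chain θ F hF 1 n (θ^[i] ω) (fiter θ F i ω x)
    rw [add_comm 1 n] at h1
    have h3 : fiter θ F 1 (θ^[n] (θ^[i] ω)) = F (θ^[n + i] ω) := by
      funext y; simp [fiter, Function.iterate_add_apply]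
    rw [h3, ← fiter_add'] at h1
    have h4 := hL (θ^[n + i] ω) (fiter θ F (n + i) ω x)
      (near_iter θ F hF Kf hK r C hC hL ω hω x k hx (n + i) (by omega)).2
    refine h1.trans ((mul_le_mul h4 h0 (norm_nonneg _) (Real.exp_pos _).le).trans ?_)
    rw [← Real.exp_add]
    apply Real.exp_le_exp.mpr
    push_cast; linarith
end

theorem aux_avg {Ω X : Type*} [MeasurableSpace Ω] [MeasurableSpace X] (P : Measure Ω)
    [IsProbabilityMeasure P] (s : Ω → X) (hs : Measurable s) (T : X → X) (hT : Measurable T)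
    (k : ℕ) (hk : k ≠ 0) :
    ∃ μ : Measure X, IsProbabilityMeasure μ ∧
      (∀ A, MeasurableSet A → μ A = (k : ENNReal)⁻¹ * ∑ j ∈ Finset.range k, P {ω | T^[j] (s ω) ∈ A}) ∧
      ∀ f : X → ℝ, Measurable f → (∃ B, ∀ p, |f p| ≤ B) →
        ∫ p, f p ∂μ = (k : ℝ)⁻¹ * ∑ j ∈ Finset.range k, ∫ ω, f (T^[j] (s ω)) ∂P := by
  have hm : ∀ j, Measurable (fun ω => T^[j] (s ω)) := fun j => (hT.iterate j).comp hs
  let μ : Measure X := (k : ENNReal)⁻¹ • ∑ j ∈ Finset.range k, P.map (fun ω => T^[j] (s ω))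
  have hA : ∀ A, MeasurableSet A →
      μ A = (k : ENNReal)⁻¹ * ∑ j ∈ Finset.range k, P {ω | T^[j] (s ω) ∈ A} := by
    intro A hA
    simp only [μ, Measure.smul_apply, Measure.finsetSum_apply, smul_eq_mul]
    congr 1
    refine Finset.sum_congr rfl fun j _ => ?_
    rw [Measure.map_apply (hm j) hA]
    rfl
  refine ⟨μ, ⟨?_⟩, hA, ?_⟩
  · rw [hA _ MeasurableSet.univ]
    simp
    exact ENNReal.inv_mul_cancel (by simpa using hk) (by simp)
  · rintro f hf ⟨B, hB⟩
    have hi : ∀ j, IsProbabilityMeasure (P.map (fun ω => T^[j] (s ω))) := fun j =>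
      Measure.isProbabilityMeasure_map (hm j).aemeasurable
    simp only [μ]
    rw [integral_smul_measure, integral_finsetSum_measure]
    · simp only [ENNReal.toReal_inv, ENNReal.toReal_natCast, smul_eq_mul]
      congr 1
      refine Finset.sum_congr rfl fun j _ => ?_
      rw [integral_map (hm j).aemeasurable hf.aestronglyMeasurable]
    · intro j _
      have := hi j
      exact Integrable.of_bound hf.aestronglyMeasurable B (ae_of_all _ hB)

section
variable {Ω E : Type*} [MeasurableSpace Ω] [NormedAddCommGroup E]
    [InnerProductSpace ℝ E] [FiniteDimensional ℝ E] [MeasurableSpace E] [BorelSpace E]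

open Classical in
/-- local supremum of the truncated log-derivative near the fibre -/
noncomputable def bF (θ : Ω → Ω) (F : Ω → E → E) (Kf : Ω → Set E) (q : ℕ → E) (C N : ℝ) (k : ℕ) (δ : ℝ)
    (ω : Ω) : ℝ :=
  ⨆ i, if infDist (q i) (Kf ω) < δ then gF θ F C N k (ω, q i) else -(N * k)

theorem bF_term_bound (θ : Ω → Ω) (F : Ω → E → E) (Kf : Ω → Set E) (q : ℕ → E) (C N : ℝ)
    (hC : 0 ≤ C) (hN : 0 ≤ N) (k : ℕ) (δ : ℝ) (ω : Ω) (i : ℕ) (x : ℝ)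
    (hx : x = gF θ F C N k (ω, q i) ∨ x = -(N * k)) : x ≤ C * k ∧ -(N * k) ≤ x := by
  have : 0 ≤ C * k := by positivity
  have : 0 ≤ N * k := by positivity
  rcases hx with rfl | rfl
  · exact ⟨gF_le _ _ _ _ _ _, le_gF _ _ _ _ hC hN _ _⟩
  · constructor <;> linarith

theorem bF_bdd (θ : Ω → Ω) (F : Ω → E → E) (Kf : Ω → Set E) (q : ℕ → E) (C N : ℝ)
    (hC : 0 ≤ C) (hN : 0 ≤ N) (k : ℕ) (δ : ℝ) (ω : Ω) :
    BddAbove (Set.range fun i => (open Classical in if infDist (q i) (Kf ω) < δ then gF θ F C N k (ω, q i) else -(N * k))) := by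
  refine ⟨C * k, ?_⟩
  rintro _ ⟨i, rfl⟩
  refine (bF_term_bound θ F Kf q C N hC hN k δ ω i _ ?_).1
  dsimp only
  split_ifs <;> simp

theorem bF_le (θ : Ω → Ω) (F : Ω → E → E) (Kf : Ω → Set E) (q : ℕ → E) (C N : ℝ)
    (hC : 0 ≤ C) (hN : 0 ≤ N) (k : ℕ) (δ : ℝ) (ω : Ω) :
    bF θ F Kf q C N k δ ω ≤ C * k := by
  refine ciSup_le fun i => ?_
  refine (bF_term_bound θ F Kf q C N hC hN k δ ω i _ ?_).1
  split_ifs <;> simp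

theorem le_bF (θ : Ω → Ω) (F : Ω → E → E) (Kf : Ω → Set E) (q : ℕ → E) (C N : ℝ)
    (hC : 0 ≤ C) (hN : 0 ≤ N) (k : ℕ) (δ : ℝ) (ω : Ω) :
    -(N * k) ≤ bF θ F Kf q C N k δ ω := by
  refine le_trans ?_ (le_ciSup (bF_bdd θ F Kf q C N hC hN k δ ω) 0)
  refine (bF_term_bound θ F Kf q C N hC hN k δ ω 0 _ ?_).2
  split_ifs <;> simp

theorem bF_abs (θ : Ω → Ω) (F : Ω → E → E) (Kf : Ω → Set E) (q : ℕ → E) (C N : ℝ)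
    (hC : 0 ≤ C) (hN : 0 ≤ N) (k : ℕ) (δ : ℝ) (ω : Ω) :
    |bF θ F Kf q C N k δ ω| ≤ (C + N) * k := by
  have h1 := bF_le θ F Kf q C N hC hN k δ ω
  have h2 := le_bF θ F Kf q C N hC hN k δ ω
  have : 0 ≤ C * k := by positivity
  have : 0 ≤ N * k := by positivity
  rw [abs_le]; constructor <;> linarith

theorem gF_le_bF (θ : Ω → Ω) (F : Ω → E → E) (Kf : Ω → Set E) (q : ℕ → E) (C N : ℝ)
    (hC : 0 ≤ C) (hN : 0 ≤ N) (k : ℕ) (δ : ℝ) (ω : Ω) (i : ℕ) (hi : infDist (q i) (Kf ω) < δ) :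
    gF θ F C N k (ω, q i) ≤ bF θ F Kf q C N k δ ω := by
  have := le_ciSup (bF_bdd θ F Kf q C N hC hN k δ ω) i
  unfold bF
  refine le_trans (le_of_eq ?_) this
  exact (if_pos hi).symm

theorem bF_meas (θ : Ω → Ω) (hθ : Measurable θ) (F : Ω → E → E) (hF : ∀ ω, ContDiff ℝ 1 (F ω))
    (hFm : ∀ x, Measurable fun ω => F ω x) (Kf : Ω → Set E)
    (hKm : ∀ x, Measurable fun ω => infDist x (Kf ω)) (q : ℕ → E) (C N : ℝ)
    (k : ℕ) (δ : ℝ) : Measurable (bF θ F Kf q C N k δ) := by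
  unfold bF
  refine Measurable.iSup fun i => ?_
  refine Measurable.ite ?_ ?_ measurable_const
  · exact measurableSet_lt (hKm _) measurable_const
  · exact (gF_meas θ hθ F hF hFm C N k).comp (measurable_id.prodMk measurable_const)

theorem exists_near (A : Set E) (q : ℕ → E) (hq : DenseRange q) (δ : ℝ) (hδ : 0 < δ) :
    ∃ i, infDist (q i) A < δ := by
  rcases A.eq_empty_or_nonempty with h | ⟨p, hp⟩
  · exact ⟨0, by simpa [h] using hδ⟩
  · obtain ⟨i, hi⟩ := hq.exists_dist_lt p hδ
    refine ⟨i, (infDist_le_dist_of_mem hp).trans_lt ?_⟩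
    rwa [dist_comm]

theorem bF_exists (θ : Ω → Ω) (F : Ω → E → E) (Kf : Ω → Set E) (q : ℕ → E) (hq : DenseRange q)
    (C N : ℝ) (hC : 0 ≤ C) (hN : 0 ≤ N) (k : ℕ) (δ : ℝ) (hδ : 0 < δ) (ω : Ω) :
    ∃ i, infDist (q i) (Kf ω) < δ ∧ bF θ F Kf q C N k δ ω - 1 ≤ gF θ F C N k (ω, q i) := by
  obtain ⟨i, hi⟩ := exists_lt_of_lt_ciSup (sub_one_lt (bF θ F Kf q C N k δ ω))
  rcases Classical.em (infDist (q i) (Kf ω) < δ) with h | h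
  · rw [if_pos h] at hi
    exact ⟨i, h, hi.le⟩
  · rw [if_neg h] at hi
    obtain ⟨j, hj⟩ := exists_near (Kf ω) q hq δ hδ
    exact ⟨j, hj, hi.le.trans (le_gF _ _ _ _ hC hN _ _)⟩

theorem infDist_joint_meas (Kf : Ω → Set E) (hKm : ∀ x, Measurable fun ω => infDist x (Kf ω)) :
    Measurable fun p : Ω × E => infDist p.2 (Kf p.1) := by
  have h3 := measurable_uncurry_of_continuous_of_measurable (u := fun x ω => infDist x (Kf ω))
    (fun ω => continuous_infDist_pt _) hKm
  have h4 : Measurable (fun p : Ω × E => (p.2, p.1)) := measurable_snd.prodMk measurable_fst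
  have h5 := Measurable.comp h3 h4
  simpa only [Function.comp_def, Function.uncurry] using h5

theorem gF_anti (θ : Ω → Ω) (F : Ω → E → E) (C N N' : ℝ) (h : N ≤ N') (n : ℕ) (p : Ω × E) :
    gF θ F C N' n p ≤ gF θ F C N n p := by
  unfold gF
  refine min_le_min_left _ (Real.log_le_log (lt_of_lt_of_le (Real.exp_pos _) (le_max_right _ _)) ?_)
  refine max_le_max_left _ (Real.exp_le_exp.mpr ?_)
  have : N * n ≤ N' * n := by gcongr
  linarith

/-- approximate invariant measures -/
def DF (P : Measure Ω) (θ : Ω → Ω) (F : Ω → E → E) (Kf : Ω → Set E) (C : ℝ) (m : ℕ) :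
    Set (Measure (Ω × E)) :=
  {μ | IsProbabilityMeasure μ ∧ μ.fst = P ∧
    (∀ f : Ω × E → ℝ, Measurable f → ∀ B : ℝ, (∀ p, |f p| ≤ B) →
      |∫ p, f (θ p.1, F p.1 p.2) ∂μ - ∫ p, f p ∂μ| ≤ B * ((m : ℝ) + 1)⁻¹) ∧
    (∀ᵐ p ∂μ, infDist p.2 (Kf p.1) ≤ ((m : ℝ) + 1)⁻¹) ∧
    ∀ n ≤ m, ∀ N ≤ m, -((m : ℝ) + 1)⁻¹ ≤ ∫ p, gF θ F C (N : ℝ) n p ∂μ}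

theorem DF_nonempty (P : Measure Ω) [IsProbabilityMeasure P]
    (θ : Ω → Ω) (hθ : MeasurePreserving θ P P) (F : Ω → E → E) (hF : ∀ ω, ContDiff ℝ 1 (F ω))
    (hFm : ∀ x, Measurable fun ω => F ω x) (Kf : Ω → Set E) (hK : ∀ ω, IsCompact (Kf ω))
    (hKm : ∀ x, Measurable fun ω => infDist x (Kf ω)) (hgood : ∀ᵐ ω ∂P, Good θ F Kf ω)
    (r C : ℝ) (hr : 0 < r) (hC : 0 ≤ C)
    (hL : ∀ ω x, infDist x (Kf ω) < r → ‖fderiv ℝ (F ω) x‖ ≤ Real.exp C)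
    (q : ℕ → E) (hq : DenseRange q)
    (hb : ∀ N : ℝ, 0 ≤ N → ∀ k : ℕ, 1 ≤ k → ∀ δ > 0, δ * Real.exp (C * k) < r →
      0 ≤ ∫ ω, bF θ F Kf q C N k δ ω ∂P) (m : ℕ) :
    (DF P θ F Kf C m).Nonempty := by
  classical
  have hm1 : (0 : ℝ) < ((m : ℝ) + 1)⁻¹ := by positivity
  obtain ⟨k, hk⟩ := exists_nat_gt (((m : ℝ) + 2 * C * m * m + 2) * (m + 1))
  have hkpos : (0 : ℝ) < k := lt_of_le_of_lt (by positivity) hk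
  have hk0 : k ≠ 0 := by rintro rfl; simp at hkpos
  have hk' : (k : ℝ)⁻¹ * ((m : ℝ) + 2 * C * m * m + 2) ≤ ((m : ℝ) + 1)⁻¹ := by
    rw [inv_mul_le_iff₀ hkpos, ← div_eq_mul_inv, le_div_iff₀ (by positivity)]
    exact hk.le
  have hTm := T_meas θ hθ.measurable F hF hFm
  obtain ⟨δ, hδ, hδ'⟩ : ∃ δ > 0, δ * Real.exp (C * (k + m : ℕ)) < min r ((m : ℝ) + 1)⁻¹ := by
    have hmin : 0 < min r ((m : ℝ) + 1)⁻¹ := lt_min hr hm1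
    refine ⟨min r ((m : ℝ) + 1)⁻¹ / 2 / Real.exp (C * (k + m : ℕ)), by positivity, ?_⟩
    rw [div_mul_cancel₀ _ (Real.exp_pos _).ne']
    linarith
  have hN : (0 : ℝ) ≤ (m : ℝ) := by positivity
  have hex := bF_exists θ F Kf q hq C (m : ℝ) hC hN (k + m) δ hδ
  set idx : Ω → ℕ := fun ω => Nat.find (hex ω) with hidx
  have hidxm : Measurable idx := by
    refine measurable_find hex fun i => ?_
    have e1 := (bF_meas θ hθ.measurable F hF hFm Kf hKm q C m (k + m) δ).sub_const 1
    have e2 : Measurable fun ω => gF θ F C m (k + m) (ω, q i) :=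
      (gF_meas θ hθ.measurable F hF hFm C m (k + m)).comp (measurable_id.prodMk measurable_const)
    exact (measurableSet_lt (hKm (q i)) (measurable_const (a := δ))).inter (measurableSet_le e1 e2)
  have hidx1 : ∀ ω, infDist (q (idx ω)) (Kf ω) < δ := fun ω => (Nat.find_spec (hex ω)).1
  have hidx2 : ∀ ω, bF θ F Kf q C m (k + m) δ ω - 1 ≤ gF θ F C m (k + m) (ω, q (idx ω)) :=
    fun ω => (Nat.find_spec (hex ω)).2
  have hqi : Measurable fun ω => q (idx ω) := (measurable_from_top (f := q)).comp hidxm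
  obtain ⟨μ, hμ, hμA, hμf⟩ := aux_avg P (fun ω => (ω, q (idx ω))) (measurable_id.prodMk hqi) _ hTm k hk0
  have hsm : Measurable fun ω => (ω, q (idx ω)) := measurable_id.prodMk hqi
  have hprodlt : ∀ ω, infDist (q (idx ω)) (Kf ω) * Real.exp (C * (k + m : ℕ)) < min r ((m : ℝ) + 1)⁻¹ :=
    fun ω => lt_of_le_of_lt (mul_le_mul_of_nonneg_right (hidx1 ω).le (Real.exp_pos _).le) hδ'
  refine ⟨μ, hμ, ?_, ?_, ?_, ?_⟩
  · ext A hA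
    rw [Measure.fst_apply hA, hμA _ (measurable_fst hA)]
    have : ∀ j ∈ Finset.range k, P {ω | (fun p : Ω × E => (θ p.1, F p.1 p.2))^[j] (ω, q (idx ω)) ∈
        Prod.fst ⁻¹' A} = P A := by
      intro j _
      simp only [fiter_iter]
      exact (hθ.iterate j).measure_preimage hA.nullMeasurableSet
    rw [Finset.sum_congr rfl this]
    simp only [Finset.sum_const, Finset.card_range, nsmul_eq_mul]
    rw [← mul_assoc, ENNReal.inv_mul_cancel (by simpa using hk0) (by simp), one_mul]
  · intro f hf B hB
    rw [hμf f hf ⟨B, hB⟩, hμf (fun p => f (θ p.1, F p.1 p.2)) (hf.comp hTm) ⟨B, fun p => hB _⟩]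
    rw [← mul_sub, ← Finset.sum_sub_distrib]
    set u : ℕ → ℝ := fun j => ∫ ω, f ((fun p : Ω × E => (θ p.1, F p.1 p.2))^[j] (ω, q (idx ω))) ∂P
    have hu : ∀ j, |u j| ≤ B := by
      intro j
      have := norm_integral_le_of_norm_le_const (μ := P)
        (f := fun ω => f ((fun p : Ω × E => (θ p.1, F p.1 p.2))^[j] (ω, q (idx ω)))) (C := B)
        (ae_of_all _ fun ω => hB _)
      simpa using this
    have htel : ∑ j ∈ Finset.range k, ((∫ ω, f (θ ((fun p : Ω × E => (θ p.1, F p.1 p.2))^[j] (ω, q (idx ω))).1,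
        F ((fun p : Ω × E => (θ p.1, F p.1 p.2))^[j] (ω, q (idx ω))).1
          ((fun p : Ω × E => (θ p.1, F p.1 p.2))^[j] (ω, q (idx ω))).2) ∂P) - u j) = u k - u 0 := by
      rw [← Finset.sum_range_sub]
      refine Finset.sum_congr rfl fun j _ => ?_
      simp only [u, Function.iterate_succ_apply']
    rw [htel, abs_mul, abs_of_pos (inv_pos.mpr hkpos)]
    have hB0 : 0 ≤ B := (abs_nonneg _).trans (hu 0)
    have h2 : |u k - u 0| ≤ 2 * B := by
      have := abs_sub (u k) (u 0)
      have := hu k; have := hu 0; linarith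
    have h3 : (k : ℝ)⁻¹ * 2 ≤ ((m : ℝ) + 1)⁻¹ := by
      refine le_trans (mul_le_mul_of_nonneg_left ?_ (inv_pos.mpr hkpos).le) hk'
      have : 0 ≤ (m : ℝ) + 2 * C * m * m := by positivity
      linarith
    calc (k : ℝ)⁻¹ * |u k - u 0| ≤ (k : ℝ)⁻¹ * (2 * B) :=
          mul_le_mul_of_nonneg_left h2 (inv_pos.mpr hkpos).le
      _ = B * ((k : ℝ)⁻¹ * 2) := by ring
      _ ≤ _ := mul_le_mul_of_nonneg_left h3 hB0
  · rw [ae_iff]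
    have hms : MeasurableSet {p : Ω × E | ¬ infDist p.2 (Kf p.1) ≤ ((m : ℝ) + 1)⁻¹} :=
      (measurableSet_le (infDist_joint_meas Kf hKm) measurable_const).compl
    rw [hμA _ hms]
    refine mul_eq_zero_of_right _ (Finset.sum_eq_zero fun j hj => ?_)
    rw [← nonpos_iff_eq_zero, ← ae_iff.mp hgood]
    refine measure_mono fun ω hω hg => ?_
    simp only [fiter_iter, Set.mem_ofPred_eq] at hω
    have hj' : j ≤ k + m := by have := Finset.mem_range.mp hj; omega
    have h1 := (near_iter θ F hF Kf hK r C hC hL ω hg (q (idx ω)) (k + m)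
      ((hprodlt ω).trans_le (min_le_left _ _)) j hj').1
    refine hω (h1.trans (le_trans ?_ ((hprodlt ω).le.trans (min_le_right _ _))))
    refine mul_le_mul_of_nonneg_left (Real.exp_le_exp.mpr ?_) infDist_nonneg
    exact mul_le_mul_of_nonneg_left (by exact_mod_cast hj') hC
  · intro n hn N hNm
    have hgi : ∀ (n N : ℕ), Integrable (gF θ F C (N : ℝ) n) μ := fun n N =>
      Integrable.of_bound (gF_meas θ hθ.measurable F hF hFm C N n).aestronglyMeasurable ((C + N) * n)
        (ae_of_all _ fun p => gF_bound θ F C N hC (by positivity) n p)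
    refine le_trans ?_ (integral_mono (hgi n m) (hgi n N) fun p =>
      gF_anti θ F C N m (by exact_mod_cast hNm) n p)
    rw [hμf _ (gF_meas θ hθ.measurable F hF hFm C m n) ⟨(C + m) * n, gF_bound θ F C m hC hN n⟩]
    have hgiP : ∀ j n, Integrable (fun ω => gF θ F C (m : ℝ) n
        ((fun p : Ω × E => (θ p.1, F p.1 p.2))^[j] (ω, q (idx ω)))) P := fun j n =>
      Integrable.of_bound ((gF_meas θ hθ.measurable F hF hFm C m n).comp
        ((hTm.iterate j).comp hsm)).aestronglyMeasurable ((C + m) * n)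
        (ae_of_all _ fun p => gF_bound θ F C m hC hN n _)
    rw [← integral_finsetSum _ (fun j _ => hgiP j n)]
    have hpt : ∀ᵐ ω ∂P, n * (bF θ F Kf q C m (k + m) δ ω - 1) - 2 * C * m * m ≤
        ∑ j ∈ Finset.range k, gF θ F C (m : ℝ) n
          ((fun p : Ω × E => (θ p.1, F p.1 p.2))^[j] (ω, q (idx ω))) := by
      filter_upwards [hgood] with ω hg
      have hx := (hprodlt ω).trans_le (min_le_left _ _)
      have hnear := near_fderiv θ F hF Kf hK r C hC hL ω hg (q (idx ω)) (k + m) hx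
      have hsa := aux_subadd (fun i j => gF θ F C m (j - i) (θ^[i] ω, fiter θ F i ω (q (idx ω)))) C hC m k n hn
        (by
          intro i j l hij hjl hl
          have h := gF_subadd θ F hF C m hC hN (l - j) (j - i) (θ^[i] ω) (fiter θ F i ω (q (idx ω)))
          rw [← fiter_add', ← Function.iterate_add_apply, show j - i + i = j by omega,
            show j - i + (l - j) = l - i by omega] at h
          exact h (hnear j (l - j) (by omega)) (hnear i (j - i) (by omega)))
        (by
          intro i j hij hj
          refine (gF_le θ F C m (j - i) _).trans ?_
          rw [Nat.cast_sub hij])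
      simp only [fiter_iter]
      simp only [Function.iterate_zero, id, fiter, Nat.sub_zero, Nat.add_sub_cancel_left] at hsa
      refine le_trans ?_ hsa
      have := mul_le_mul_of_nonneg_left (hidx2 ω) (Nat.cast_nonneg (α := ℝ) n)
      linarith
    have hbi : Integrable (fun ω => bF θ F Kf q C m (k + m) δ ω) P :=
      Integrable.of_bound (bF_meas θ hθ.measurable F hF hFm Kf hKm q C m (k + m) δ).aestronglyMeasurable
        ((C + m) * (k + m : ℕ)) (ae_of_all _ fun ω => bF_abs θ F Kf q C m hC hN _ δ ω)
    have hint := integral_mono_ae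
      (((hbi.sub (integrable_const 1)).const_mul (n : ℝ)).sub (integrable_const (2 * C * m * m)))
      (integrable_finsetSum _ (fun j _ => hgiP j n)) hpt
    have hb0 := hb m hN (k + m) (by omega) δ hδ (hδ'.trans_le (min_le_left _ _))
    have hcalc : ∫ ω, (n * (bF θ F Kf q C m (k + m) δ ω - 1) - 2 * C * m * m) ∂P =
        n * ((∫ ω, bF θ F Kf q C m (k + m) δ ω ∂P) - 1) - 2 * C * m * m := by
      have e1 : Integrable (fun ω => (n : ℝ) * (bF θ F Kf q C m (k + m) δ ω - 1)) P :=
        (hbi.sub (integrable_const 1)).const_mul (n : ℝ)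
      rw [integral_sub e1 (integrable_const _), integral_const_mul, integral_sub hbi (integrable_const _)]
      simp
    have hlow : -((m : ℝ) + 2 * C * m * m + 2) ≤ ∫ ω, ∑ j ∈ Finset.range k, gF θ F C (m : ℝ) n
          ((fun p : Ω × E => (θ p.1, F p.1 p.2))^[j] (ω, q (idx ω))) ∂P := by
      refine le_trans ?_ hint
      refine le_trans ?_ hcalc.ge
      have hnm : (n : ℝ) ≤ m := by exact_mod_cast hn
      have : 0 ≤ (n : ℝ) * (∫ ω, bF θ F Kf q C m (k + m) δ ω ∂P) := by positivity
      nlinarith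
    have := mul_le_mul_of_nonneg_left hlow (inv_pos.mpr hkpos).le
    linarith
end

section
variable {Ω E : Type*} [MeasurableSpace Ω] [NormedAddCommGroup E]
    [InnerProductSpace ℝ E] [FiniteDimensional ℝ E] [MeasurableSpace E] [BorelSpace E]

theorem DF_anti (P : Measure Ω) (θ : Ω → Ω) (F : Ω → E → E) (Kf : Ω → Set E) (C : ℝ) :
    Antitone (DF P θ F Kf C) := by
  rintro m m' hmm μ ⟨h1, h2, h3, h4, h5⟩
  have hle : ((m' : ℝ) + 1)⁻¹ ≤ ((m : ℝ) + 1)⁻¹ := by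
    apply inv_anti₀ (by positivity)
    have : (m : ℝ) ≤ m' := by exact_mod_cast hmm
    linarith
  refine ⟨h1, h2, ?_, ?_, ?_⟩
  · intro f hf B hB
    have : Nonempty (Ω × E) := by
      by_contra hc
      have := not_nonempty_iff.mp hc
      have h := h1.measure_univ
      simp [Set.eq_empty_of_isEmpty] at h
    have hB0 : 0 ≤ B := (abs_nonneg _).trans (hB (Classical.choice this))
    exact (h3 f hf B hB).trans (mul_le_mul_of_nonneg_left hle hB0)
  · filter_upwards [h4] with p hp using hp.trans hle
  · intro n hn N hN
    have := h5 n (hn.trans hmm) N (hN.trans hmm)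
    linarith

theorem half_integral (μ ν : Measure (Ω × E)) [IsProbabilityMeasure μ] [IsProbabilityMeasure ν]
    (f : Ω × E → ℝ) (hf : Measurable f) (B : ℝ) (hB : ∀ p, |f p| ≤ B) :
    ∫ p, f p ∂((2⁻¹ : ENNReal) • (μ + ν)) = (1 / 2) * (∫ p, f p ∂μ) + (1 / 2) * ∫ p, f p ∂ν := by
  rw [integral_smul_measure, integral_add_measure
    (Integrable.of_bound hf.aestronglyMeasurable B (ae_of_all _ hB))
    (Integrable.of_bound hf.aestronglyMeasurable B (ae_of_all _ hB))]
  simp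
  ring

theorem half_prob {X : Type*} [MeasurableSpace X] (μ ν : Measure X) [IsProbabilityMeasure μ]
    [IsProbabilityMeasure ν] : IsProbabilityMeasure ((2⁻¹ : ENNReal) • (μ + ν)) := ⟨by
  simp only [Measure.smul_apply, Measure.add_apply, smul_eq_mul, measure_univ]
  rw [one_add_one_eq_two]
  exact ENNReal.inv_mul_cancel (by simp) (by simp)⟩

theorem DF_mid (P : Measure Ω) (θ : Ω → Ω) (hθ : Measurable θ) (F : Ω → E → E)
    (hF : ∀ ω, ContDiff ℝ 1 (F ω))
    (hFm : ∀ x, Measurable fun ω => F ω x) (Kf : Ω → Set E) (C : ℝ) (hC : 0 ≤ C) (m : ℕ) :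
    ∀ μ ∈ DF P θ F Kf C m, ∀ ν ∈ DF P θ F Kf C m, (2⁻¹ : ENNReal) • (μ + ν) ∈ DF P θ F Kf C m := by
  rintro μ ⟨h1, h2, h3, h4, h5⟩ ν ⟨k1, k2, k3, k4, k5⟩
  have hTm := T_meas θ hθ F hF hFm
  refine ⟨half_prob μ ν, ?_, ?_, ?_, ?_⟩
  · ext A hA
    rw [Measure.fst_apply hA]
    simp only [Measure.smul_apply, Measure.add_apply, smul_eq_mul]
    rw [← Measure.fst_apply hA, ← Measure.fst_apply hA, h2, k2, ← two_mul, ← mul_assoc,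
      ENNReal.inv_mul_cancel (by simp) (by simp), one_mul]
  · intro f hf B hB
    rw [half_integral μ ν f hf B hB, half_integral μ ν (fun p => f (θ p.1, F p.1 p.2)) (hf.comp hTm) B
      (fun p => hB _)]
    have e1 := abs_le.mp (h3 f hf B hB)
    have e2 := abs_le.mp (k3 f hf B hB)
    rw [abs_le]
    constructor <;> linarith [e1.1, e1.2, e2.1, e2.2]
  · refine Measure.ae_smul_measure ?_ _
    rw [ae_add_measure_iff]
    exact ⟨h4, k4⟩
  · intro n hn N hN
    rw [half_integral μ ν _ (gF_meas θ hθ F hF hFm C N n) _ (gF_bound θ F C N hC (by positivity) n)]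
    linarith [h5 n hn N hN, k5 n hn N hN]

theorem aux_inv_ext (μ ν : Measure (Ω × E)) [IsProbabilityMeasure μ] [IsProbabilityMeasure ν]
    (h : ∀ A : Set Ω, MeasurableSet A → ∀ φ : BoundedContinuousFunction E ℝ,
      ∫ p, A.indicator (fun _ => φ p.2) p.1 ∂μ = ∫ p, A.indicator (fun _ => φ p.2) p.1 ∂ν) : μ = ν := by
  refine Measure.ext_prod fun {A B} hA hB => ?_
  have key : (μ.restrict (Prod.fst ⁻¹' A)).map Prod.snd = (ν.restrict (Prod.fst ⁻¹' A)).map Prod.snd := by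
    apply ext_of_forall_integral_eq_of_IsFiniteMeasure
    intro φ
    have hA' : MeasurableSet (Prod.fst ⁻¹' A : Set (Ω × E)) := measurable_fst hA
    rw [integral_map measurable_snd.aemeasurable φ.continuous.aestronglyMeasurable,
      integral_map measurable_snd.aemeasurable φ.continuous.aestronglyMeasurable,
      ← integral_indicator hA', ← integral_indicator hA']
    exact h A hA φ
  have := congrArg (fun ρ : Measure E => ρ B) key
  simp only [Measure.map_apply measurable_snd hB] at this
  rw [Measure.restrict_apply (measurable_snd hB), Measure.restrict_apply (measurable_snd hB)] at this
  rw [Set.prod_eq, Set.inter_comm]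
  exact this

theorem caseII_supp (μs : ℕ → Measure (Ω × E)) (hp : ∀ j, IsProbabilityMeasure (μs j))
    (μ : Measure (Ω × E)) [IsProbabilityMeasure μ] (f : Ω × E → ℝ) (hf : Measurable f)
    (hf0 : ∀ p, 0 ≤ f p) (hfb : ∀ p, |f p| ≤ 1)
    (h1 : Tendsto (fun j => ∫ p, f p ∂(μs j)) atTop (nhds (∫ p, f p ∂μ)))
    (hae : ∀ j : ℕ, ∀ᵐ p ∂(μs j), f p ≤ ((j : ℝ) + 1)⁻¹) : ∀ᵐ p ∂μ, f p = 0 := by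
  have hlim0 : Tendsto (fun j : ℕ => ((j : ℝ) + 1)⁻¹) atTop (nhds 0) := by
    simpa using tendsto_one_div_add_atTop_nhds_zero_nat (𝕜 := ℝ)
  have h2 : ∫ p, f p ∂μ ≤ 0 := by
    refine le_of_tendsto_of_tendsto' h1 hlim0 fun j => ?_
    have := hp j
    have h3 : ∫ p, f p ∂(μs j) ≤ ∫ p, ((j : ℝ) + 1)⁻¹ ∂(μs j) :=
      integral_mono_ae (Integrable.of_bound hf.aestronglyMeasurable 1 (ae_of_all _ hfb))
        (integrable_const _) (hae j)
    simpa using h3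
  exact (integral_eq_zero_iff_of_nonneg hf0
      (Integrable.of_bound hf.aestronglyMeasurable 1 (ae_of_all _ hfb))).mp
      (le_antisymm h2 (integral_nonneg hf0))

set_option maxHeartbeats 2000000 in
theorem caseII (P : Measure Ω) [IsProbabilityMeasure P]
    (θ : Ω → Ω) (hθ : MeasurePreserving θ P P) (F : Ω → E → E) (hF : ∀ ω, ContDiff ℝ 1 (F ω))
    (hFm : ∀ x, Measurable fun ω => F ω x) (Kf : Ω → Set E) (hK : ∀ ω, IsCompact (Kf ω))
    (hKm : ∀ x, Measurable fun ω => infDist x (Kf ω)) (hgood : ∀ᵐ ω ∂P, Good θ F Kf ω)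
    (r C : ℝ) (hr : 0 < r) (hC : 0 ≤ C)
    (hL : ∀ ω x, infDist x (Kf ω) < r → ‖fderiv ℝ (F ω) x‖ ≤ Real.exp C)
    (q : ℕ → E) (hq : DenseRange q)
    (hb : ∀ N : ℝ, 0 ≤ N → ∀ k : ℕ, 1 ≤ k → ∀ δ > 0, δ * Real.exp (C * k) < r →
      0 ≤ ∫ ω, bF θ F Kf q C N k δ ω ∂P) :
    ∃ μ : Measure (Ω × E), IsProbabilityMeasure μ ∧
      μ.map (fun p : Ω × E => (θ p.1, F p.1 p.2)) = μ ∧ μ.map Prod.fst = P ∧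
      (∀ᵐ p ∂μ, p.2 ∈ Kf p.1) ∧ ∀ n N : ℕ, 0 ≤ ∫ p, gF θ F C (N : ℝ) n p ∂μ := by
  have hTm := T_meas θ hθ.measurable F hF hFm
  have hgp : ∀ μ : Measure (Ω × E), μ.fst = P → ∀ᵐ p ∂μ, Good θ F Kf p.1 := by
    intro μ hμ
    refine ae_of_ae_map (f := Prod.fst) (p := fun ω => Good θ F Kf ω) measurable_fst.aemeasurable ?_
    rw [← Measure.fst, hμ]; exact hgood
  obtain ⟨μs, hμs, μ, hμ, hfst, hconv⟩ := aux_compact P (DF P θ F Kf C) (DF_anti P θ F Kf C)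
    (DF_nonempty P θ hθ F hF hFm Kf hK hKm hgood r C hr hC hL q hq hb)
    (fun μ h => h.1) (fun μ h => h.2.1) (DF_mid P θ hθ.measurable F hF hFm Kf C hC)
    (fun ω => cthickening 1 (Kf ω)) (fun ω => (hK ω).cthickening) (by
      intro μ h
      filter_upwards [h.2.2.2.1, hgp μ h.2.1] with p hp hg
      obtain ⟨y, hy, hye⟩ := (hK p.1).exists_infDist_eq_dist (hg 0).1 p.2
      refine mem_cthickening_of_dist_le p.2 y 1 _ hy ?_
      rw [← hye]
      simpa using hp)
  have hlim0 : Tendsto (fun j : ℕ => ((j : ℝ) + 1)⁻¹) atTop (nhds 0) := by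
    simpa using tendsto_one_div_add_atTop_nhds_zero_nat (𝕜 := ℝ)
  refine ⟨μ, hμ, ?_, hfst, ?_, ?_⟩
  · have : IsProbabilityMeasure (μ.map (fun p : Ω × E => (θ p.1, F p.1 p.2))) :=
      Measure.isProbabilityMeasure_map hTm.aemeasurable
    refine aux_inv_ext _ _ fun A hA φ => ?_
    set f : Ω × E → ℝ := fun p => A.indicator (fun _ => φ p.2) p.1 with hfdef
    have hf : Measurable f := by
      have : f = (Prod.fst ⁻¹' A).indicator (fun p => φ p.2) := by
        funext p; simp only [f, Set.indicator, Set.mem_preimage]; rfl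
      rw [this]
      exact (φ.continuous.measurable.comp measurable_snd).indicator (measurable_fst hA)
    have hfc : ∀ ω, Continuous fun x => f (ω, x) := by
      intro ω
      rcases Classical.em (ω ∈ A) with h | h
      · simpa [f, h] using φ.continuous
      · simpa [f, h] using continuous_const
    have hfb : ∀ p, |f p| ≤ ‖φ‖ := by
      intro p
      rcases Classical.em (p.1 ∈ A) with h | h
      · simpa [f, h] using φ.norm_coe_le_norm p.2
      · simp [f, h]
    rw [integral_map hTm.aemeasurable hf.aestronglyMeasurable]
    have h1 := hconv f hf hfc ⟨_, hfb⟩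
    have h2 := hconv (fun p => f (θ p.1, F p.1 p.2)) (hf.comp hTm)
      (fun ω => (hfc (θ ω)).comp (hF ω).continuous) ⟨_, fun p => hfb _⟩
    have h3 := (h2.sub h1).abs
    have h4 : Tendsto (fun j : ℕ => ‖φ‖ * ((j : ℝ) + 1)⁻¹) atTop (nhds 0) := by
      simpa using hlim0.const_mul ‖φ‖
    have h5 := le_of_tendsto_of_tendsto' h3 h4 (fun j => (hμs j).2.2.1 f hf _ hfb)
    exact sub_eq_zero.mp (abs_nonpos_iff.mp h5)
  · have hf : Measurable (fun p : Ω × E => min 1 (infDist p.2 (Kf p.1))) :=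
      measurable_const.min (infDist_joint_meas Kf hKm)
    have hf0 : ∀ p : Ω × E, 0 ≤ min 1 (infDist p.2 (Kf p.1)) := fun p => le_min zero_le_one infDist_nonneg
    have hfb : ∀ p : Ω × E, |min 1 (infDist p.2 (Kf p.1))| ≤ 1 := fun p => by
      rw [abs_of_nonneg (hf0 p)]; exact min_le_left _ _
    have h3 := caseII_supp μs (fun j => (hμs j).1) μ _ hf hf0 hfb
      (hconv _ hf (fun ω => continuous_const.min (continuous_infDist_pt (Kf ω))) ⟨1, hfb⟩) (by
        intro j
        filter_upwards [(hμs j).2.2.2.1] with p hp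
        exact (min_le_right _ _).trans hp)
    filter_upwards [h3, hgp μ hfst] with p hp hg
    have hp' : min 1 (infDist p.2 (Kf p.1)) = 0 := hp
    have h4 : infDist p.2 (Kf p.1) = 0 := by
      rcases min_choice 1 (infDist p.2 (Kf p.1)) with h | h
      · rw [h] at hp'; norm_num at hp'
      · rw [h] at hp'; exact hp'
    exact ((hK p.1).isClosed.mem_iff_infDist_zero (hg 0).1).mpr h4
  · intro n N
    have h1 := hconv (gF θ F C N n) (gF_meas θ hθ.measurable F hF hFm C N n)
      (gF_cont θ F hF C N n) ⟨_, gF_bound θ F C N hC (by positivity) n⟩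
    have h2 : Tendsto (fun j : ℕ => -((j : ℝ) + 1)⁻¹) atTop (nhds 0) := by simpa using hlim0.neg
    refine le_of_tendsto_of_tendsto h2 h1 ?_
    filter_upwards [eventually_ge_atTop (max n N)] with j hj
    exact (hμs j).2.2.2.2 n ((le_max_left _ _).trans hj) N ((le_max_right _ _).trans hj)
end

section
variable {Ω E : Type*} [MeasurableSpace Ω] [NormedAddCommGroup E]
    [InnerProductSpace ℝ E] [FiniteDimensional ℝ E] [MeasurableSpace E] [BorelSpace E]

theorem lyap_nonneg (θ : Ω → Ω) (hθ : Measurable θ) (F : Ω → E → E) (hF : ∀ ω, ContDiff ℝ 1 (F ω))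
    (hFm : ∀ x, Measurable fun ω => F ω x) (C : ℝ) (hC : 0 ≤ C)
    (μ : Measure (Ω × E)) [IsProbabilityMeasure μ]
    (n : ℕ) (hn : n ≠ 0) (h : ∀ N : ℕ, 0 ≤ ∫ p, gF θ F C (N : ℝ) n p ∂μ) :
    0 ≤ ∫ p, Real.log ‖fderiv ℝ (fiter θ F n p.1) p.2‖ ∂μ := by
  rcases Classical.em (Integrable (fun p : Ω × E => Real.log ‖fderiv ℝ (fiter θ F n p.1) p.2‖) μ) with hi | hi
  swap
  · rw [integral_undef hi]
  set u : Ω × E → ℝ := fun p => Real.log ‖fderiv ℝ (fiter θ F n p.1) p.2‖ with hu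
  have hn' : (1 : ℝ) ≤ n := by exact_mod_cast Nat.one_le_iff_ne_zero.mpr hn
  have h0 : ∀ N : ℕ, 0 ≤ ∫ p, max (u p) (-((N : ℝ) * n)) ∂μ := by
    intro N
    refine (h N).trans (integral_mono ?_ ?_ ?_)
    · exact Integrable.of_bound (gF_meas θ hθ F hF hFm C N n).aestronglyMeasurable ((C + N) * n)
        (ae_of_all _ fun p => gF_bound θ F C N hC (by positivity) n p)
    · exact hi.sup (integrable_const _)
    · intro p
      refine (min_le_right _ _).trans ?_
      rcases eq_or_lt_of_le (norm_nonneg (fderiv ℝ (fiter θ F n p.1) p.2)) with h1 | h1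
      · rw [← h1, max_eq_right (Real.exp_pos _).le, Real.log_exp]
        exact le_max_right _ _
      · rcases max_choice ‖fderiv ℝ (fiter θ F n p.1) p.2‖ (Real.exp (-((N : ℝ) * n))) with h2 | h2
        · rw [h2]; exact le_max_left _ _
        · rw [h2, Real.log_exp]; exact le_max_right _ _
  refine ge_of_tendsto' (f := fun N : ℕ => ∫ p, max (u p) (-((N : ℝ) * n)) ∂μ) (x := atTop) ?_ h0
  refine tendsto_integral_of_dominated_convergence (fun p => |u p|) ?_ hi.abs ?_ ?_
  · intro N
    exact (hi.sup (integrable_const _)).aestronglyMeasurable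
  · intro N
    refine ae_of_all _ fun p => ?_
    have hNn : 0 ≤ (N : ℝ) * n := by positivity
    rw [Real.norm_eq_abs, abs_le]
    constructor
    · exact (neg_abs_le _).trans (le_max_left _ _)
    · exact max_le (le_abs_self _) (by have := abs_nonneg (u p); linarith)
  · refine ae_of_all _ fun p => ?_
    refine tendsto_const_nhds.congr' ?_
    obtain ⟨N0, hN0⟩ := exists_nat_ge (-(u p))
    filter_upwards [eventually_ge_atTop N0] with N hN
    rw [max_eq_left]
    have h1 : (N0 : ℝ) ≤ N := by exact_mod_cast hN
    have h2 : (0 : ℝ) ≤ N := by positivity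
    nlinarith

theorem bF_lip (θ : Ω → Ω) (F : Ω → E → E) (hF : ∀ ω, ContDiff ℝ 1 (F ω)) (Kf : Ω → Set E)
    (hK : ∀ ω, IsCompact (Kf ω)) (r C : ℝ) (hC : 0 ≤ C)
    (hL : ∀ ω x, infDist x (Kf ω) < r → ‖fderiv ℝ (F ω) x‖ ≤ Real.exp C)
    (q : ℕ → E) (hq : DenseRange q) (N : ℝ) (hN : 0 ≤ N) (k : ℕ) (δ : ℝ)
    (hδ' : δ * Real.exp (C * k) < r)
    (ω : Ω) (hω : Good θ F Kf ω) (z x : E) (hz : z ∈ Kf ω) (hx : dist x z < δ) :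
    dist (fiter θ F k ω x) (fiter θ F k ω z) ≤ Real.exp (bF θ F Kf q C N k δ ω) * dist x z := by
  have hg : ∀ y, infDist y (Kf ω) < δ → gF θ F C N k (ω, y) ≤ bF θ F Kf q C N k δ ω := by
    intro y hy
    by_contra hcon
    push Not at hcon
    have hop : IsOpen ({y : E | infDist y (Kf ω) < δ} ∩
        {y | bF θ F Kf q C N k δ ω < gF θ F C N k (ω, y)}) :=
      (isOpen_lt (continuous_infDist_pt _) continuous_const).inter
        (isOpen_lt continuous_const (gF_cont θ F hF C N k ω))
    obtain ⟨i, hi1, hi2⟩ := hq.exists_mem_open hop ⟨y, hy, hcon⟩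
    exact absurd (gF_le_bF θ F Kf q C N hC hN k δ ω i hi1) (not_le.mpr hi2)
  have hd : ∀ y ∈ ball z δ, ‖fderiv ℝ (fiter θ F k ω) y‖ ≤ Real.exp (bF θ F Kf q C N k δ ω) := by
    intro y hy
    have h1 : infDist y (Kf ω) < δ := (infDist_le_dist_of_mem hz).trans_lt hy
    have h2 := near_fderiv θ F hF Kf hK r C hC hL ω hω y k
      (lt_of_le_of_lt (mul_le_mul_of_nonneg_right h1.le (Real.exp_pos _).le) hδ') 0 k (by omega)
    simp only [Function.iterate_zero, id, fiter] at h2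
    have h3 := exp_gF θ F C N hC hN k (ω, y) h2
    refine (le_max_left _ _).trans (h3.ge.trans (Real.exp_le_exp.mpr (hg y h1)))
  have hδ : 0 < δ := dist_nonneg.trans_lt hx
  have := (convex_ball z δ).norm_image_sub_le_of_norm_fderiv_le (f := fiter θ F k ω) (x := z) (y := x)
    (𝕜 := ℝ) (fun y _ => (fiter_contDiff θ F hF k ω).differentiable one_ne_zero y) hd
    (mem_ball_self hδ) hx
  rwa [← dist_eq_norm, ← dist_eq_norm] at this

theorem bF_contract (θ : Ω → Ω) (F : Ω → E → E) (hF : ∀ ω, ContDiff ℝ 1 (F ω)) (Kf : Ω → Set E)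
    (hK : ∀ ω, IsCompact (Kf ω)) (r C : ℝ) (hC : 0 ≤ C)
    (hL : ∀ ω x, infDist x (Kf ω) < r → ‖fderiv ℝ (F ω) x‖ ≤ Real.exp C)
    (q : ℕ → E) (hq : DenseRange q) (N : ℝ) (hN : 0 ≤ N) (k : ℕ) (δ ε : ℝ) (hε : 0 < ε)
    (hδ' : δ * Real.exp (C * k) < r)
    (ω : Ω) (hω : Good θ F Kf ω)
    (hS : ∀ n : ℕ, ∑ j ∈ Finset.range n, (bF θ F Kf q C N k δ ((θ^[k])^[j] ω) + ε) ≤ 0)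
    (z x : E) (hz : z ∈ Kf ω) (hx : dist x z < δ) (n : ℕ) :
    dist (fiter θ F (k * n) ω x) (fiter θ F (k * n) ω z) ≤ Real.exp (-(ε * n)) * δ := by
  have hδ : 0 < δ := dist_nonneg.trans_lt hx
  have hS' : ∀ n : ℕ, ∑ j ∈ Finset.range n, bF θ F Kf q C N k δ ((θ^[k])^[j] ω) ≤ -(ε * n) := by
    intro n
    have := hS n
    rw [Finset.sum_add_distrib] at this
    simp at this
    linarith
  have main : ∀ n : ℕ, dist (fiter θ F (k * n) ω x) (fiter θ F (k * n) ω z) ≤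
      Real.exp (∑ j ∈ Finset.range n, bF θ F Kf q C N k δ ((θ^[k])^[j] ω)) * dist x z := by
    intro n
    induction n with
    | zero => simp [fiter]
    | succ n ih =>
      have e1 : ∀ y, fiter θ F (k * (n + 1)) ω y = fiter θ F k (θ^[k * n] ω) (fiter θ F (k * n) ω y) := by
        intro y
        rw [← fiter_add']; congr 1; ring
      have h1 : Real.exp (∑ j ∈ Finset.range n, bF θ F Kf q C N k δ ((θ^[k])^[j] ω)) * dist x z < δ := by
        refine lt_of_le_of_lt ?_ hx
        refine mul_le_of_le_one_left dist_nonneg (Real.exp_le_one_iff.mpr ((hS' n).trans ?_))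
        have : 0 ≤ ε * n := by positivity
        linarith
      have h2 := bF_lip θ F hF Kf hK r C hC hL q hq N hN k δ hδ' (θ^[k * n] ω) (hω.iter _)
        (fiter θ F (k * n) ω z) (fiter θ F (k * n) ω x)
        (by rw [← hω.image]; exact Set.mem_image_of_mem _ hz) (ih.trans_lt h1)
      rw [e1, e1]
      refine h2.trans ((mul_le_mul_of_nonneg_left ih (Real.exp_pos _).le).trans ?_)
      rw [Finset.sum_range_succ, ← Function.iterate_mul, Real.exp_add]
      apply le_of_eq; ring
  refine (main n).trans (mul_le_mul (Real.exp_le_exp.mpr (hS' n)) hx.le dist_nonneg (Real.exp_pos _).le)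

/-- fibres containing `M + 1` separated points at scale index at most `L` -/
def WF (Kf : Ω → Set E) (q : ℕ → E) (M L : ℕ) : Set Ω :=
  {ω | ∃ l : Fin (L + 1), ∃ a : Fin (M + 1) → ℕ, (∀ j, infDist (q (a j)) (Kf ω) < ((l : ℕ) + 1 : ℝ)⁻¹) ∧
    ∀ j j', j ≠ j' → 3 * ((l : ℕ) + 1 : ℝ)⁻¹ ≤ dist (q (a j)) (q (a j'))}

theorem WF_meas (Kf : Ω → Set E) (hKm : ∀ x, Measurable fun ω => infDist x (Kf ω)) (q : ℕ → E)
    (M L : ℕ) : MeasurableSet (WF Kf q M L) := by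
  have : WF Kf q M L = ⋃ l : Fin (L + 1), ⋃ a : Fin (M + 1) → ℕ,
      (⋂ j, {ω | infDist (q (a j)) (Kf ω) < ((l : ℕ) + 1 : ℝ)⁻¹}) ∩
      {_ω | ∀ j j', j ≠ j' → 3 * ((l : ℕ) + 1 : ℝ)⁻¹ ≤ dist (q (a j)) (q (a j'))} := by
    ext ω
    simp only [WF, Set.mem_ofPred_eq, Set.mem_iUnion, Set.mem_inter_iff, Set.mem_iInter]
  rw [this]
  refine MeasurableSet.iUnion fun l => MeasurableSet.iUnion fun a => ?_
  exact (MeasurableSet.iInter fun j => measurableSet_lt (hKm _) measurable_const).inter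
    (MeasurableSet.const _)

theorem WF_mono (Kf : Ω → Set E) (q : ℕ → E) (M : ℕ) : Monotone (WF Kf q M) := by
  rintro L L' h ω ⟨l, a, h1⟩
  exact ⟨⟨l, by omega⟩, a, h1⟩

theorem WF_points (Kf : Ω → Set E) (hne : ∀ ω, IsCompact (Kf ω)) (q : ℕ → E) (M L : ℕ) (ω : Ω)
    (hn : (Kf ω).Nonempty) (h : ω ∈ WF Kf q M L) :
    ∃ y : Fin (M + 1) → E, (∀ j, y j ∈ Kf ω) ∧ ∀ j j', j ≠ j' → ((L : ℝ) + 1)⁻¹ < dist (y j) (y j') := by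
  obtain ⟨l, a, h1, h2⟩ := h
  have h3 : ∀ j, ∃ y ∈ Kf ω, dist (q (a j)) y < ((l : ℕ) + 1 : ℝ)⁻¹ := fun j =>
    (infDist_lt_iff hn).mp (h1 j)
  choose y hy hyd using h3
  refine ⟨y, hy, fun j j' hj => ?_⟩
  have e1 := h2 j j' hj
  have e2 := hyd j
  have e3 := hyd j'
  have e4 := dist_triangle4 (q (a j)) (y j) (y j') (q (a j'))
  rw [dist_comm (y j') (q (a j'))] at e4
  have e5 : ((L : ℝ) + 1)⁻¹ ≤ ((l : ℕ) + 1 : ℝ)⁻¹ := by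
    apply inv_anti₀ (by positivity)
    have : ((l : ℕ) : ℝ) ≤ L := by exact_mod_cast Nat.lt_succ_iff.mp l.2
    linarith
  linarith

theorem WF_iff (Kf : Ω → Set E) (hK : ∀ ω, IsCompact (Kf ω)) (q : ℕ → E) (hq : DenseRange q) (M : ℕ) (ω : Ω)
    (hn : (Kf ω).Nonempty) : ω ∈ (⋃ L, WF Kf q M L) ↔ ((M + 1 : ℕ) : ℕ∞) ≤ (Kf ω).encard := by
  constructor
  · intro h
    obtain ⟨L, hL⟩ := Set.mem_iUnion.mp h
    obtain ⟨y, hy, hyd⟩ := WF_points Kf hK q M L ω hn hL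
    have hinj : Function.Injective y := by
      intro j j' hj
      by_contra hne
      have := hyd j j' hne
      rw [hj, dist_self] at this
      have h2 : (0 : ℝ) < ((L : ℝ) + 1)⁻¹ := by positivity
      linarith
    have h1 : Set.range y ⊆ Kf ω := by rintro _ ⟨j, rfl⟩; exact hy j
    refine le_trans (le_of_eq ?_) (Set.encard_le_encard h1)
    rw [← Set.image_univ, hinj.encard_image]
    simp
  · intro h
    obtain ⟨t, ht, htc⟩ := Set.exists_subset_encard_eq h
    have hfin : t.Finite := Set.finite_of_encard_eq_coe htc
    have hcard : Nat.card t = M + 1 := by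
      have h1 : t.ncard = M + 1 := by rw [Set.ncard, htc]; rfl
      exact h1
    have := hfin.fintype
    let e : Fin (M + 1) ≃ t := (Finite.equivFinOfCardEq hcard).symm
    obtain ⟨ρ, hρ, hρd⟩ : ∃ ρ > 0, ∀ j j', j ≠ j' → ρ ≤ dist (e j : E) (e j') := by
      have hev : ∀ᶠ ρ in nhdsWithin (0 : ℝ) (Set.Ioi 0), ∀ jj : Fin (M + 1) × Fin (M + 1),
          jj.1 ≠ jj.2 → ρ ≤ dist (e jj.1 : E) (e jj.2) := by
        rw [eventually_all]
        intro jj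
        rcases Classical.em (jj.1 = jj.2) with h | h
        · exact Eventually.of_forall fun ρ h' => absurd h h'
        · have : 0 < dist (e jj.1 : E) (e jj.2) := dist_pos.mpr fun h' =>
            h (e.injective (Subtype.ext h'))
          filter_upwards [nhdsWithin_le_nhds (Iio_mem_nhds this)] with ρ hρ _
          exact le_of_lt hρ
      obtain ⟨ρ, h1, h2⟩ := (hev.and self_mem_nhdsWithin).exists
      exact ⟨ρ, h2, fun j j' h => h1 (j, j') h⟩
    obtain ⟨l, hl⟩ := exists_nat_one_div_lt (show 0 < ρ / 5 by positivity)
    rw [one_div] at hl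
    have hlp : (0 : ℝ) < ((l : ℝ) + 1)⁻¹ := by positivity
    have h3 : ∀ j, ∃ i, dist (e j : E) (q i) < ((l : ℝ) + 1)⁻¹ := fun j => hq.exists_dist_lt _ hlp
    choose a ha using h3
    refine Set.mem_iUnion.mpr ⟨l, ⟨l, by omega⟩, a, fun j => ?_, fun j j' hj => ?_⟩
    · refine (infDist_le_dist_of_mem (ht (e j).2)).trans_lt ?_
      rw [dist_comm]; exact ha j
    · have e1 := hρd j j' hj
      have e2 := ha j
      have e3 := ha j'
      have e4 := dist_triangle4 (e j : E) (q (a j)) (q (a j')) (e j')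
      rw [dist_comm (q (a j')) (e j' : E)] at e4
      simp only
      linarith

theorem caseI (P : Measure Ω) [IsProbabilityMeasure P]
    (θ : Ω → Ω) (hθ : MeasurePreserving θ P P) (F : Ω → E → E) (hF : ∀ ω, ContDiff ℝ 1 (F ω))
    (hFm : ∀ x, Measurable fun ω => F ω x) (Kf : Ω → Set E) (hK : ∀ ω, IsCompact (Kf ω))
    (hKm : ∀ x, Measurable fun ω => infDist x (Kf ω)) (hgood : ∀ᵐ ω ∂P, Good θ F Kf ω)
    (r C : ℝ) (hC : 0 ≤ C)
    (hL : ∀ ω x, infDist x (Kf ω) < r → ‖fderiv ℝ (F ω) x‖ ≤ Real.exp C)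
    (q : ℕ → E) (hq : DenseRange q) (N : ℝ) (hN : 0 ≤ N) (k : ℕ) (δ : ℝ) (hδ : 0 < δ)
    (hδ' : δ * Real.exp (C * k) < r) (hneg : ∫ ω, bF θ F Kf q C N k δ ω ∂P < 0) :
    ∃ M, ¬ (∀ᵐ ω ∂P, ω ∈ ⋃ L, WF Kf q M L) := by
  by_contra hcon
  push Not at hcon
  set ε : ℝ := -(∫ ω, bF θ F Kf q C N k δ ω ∂P) / 2 with hεdef
  have hε : 0 < ε := by rw [hεdef]; linarith
  have hbm := bF_meas θ hθ.measurable F hF hFm Kf hKm q C N k δ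
  have hba := bF_abs θ F Kf q C N hC hN k δ
  have hbi : Integrable (fun ω => bF θ F Kf q C N k δ ω) P :=
    Integrable.of_bound hbm.aestronglyMeasurable _ (ae_of_all _ hba)
  have hZ := aux_maximal P (θ^[k]) (hθ.iterate k) (fun ω => bF θ F Kf q C N k δ ω + ε)
    (hbm.add_const ε) ((C + N) * k + ε) (by
      intro ω
      refine (abs_add_le _ _).trans ?_
      rw [abs_of_pos hε]
      linarith [hba ω]) (by
      rw [integral_add hbi (integrable_const _)]
      simp
      rw [hεdef]; linarith)
  set Z := {ω | ∀ n : ℕ, ∑ j ∈ Finset.range n, (bF θ F Kf q C N k δ ((θ^[k])^[j] ω) + ε) ≤ 0} with hZdef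
  let ZM : ℕ → Set Ω := fun M => {ω | ω ∈ Z ∧ Good θ F Kf ω ∧
    ∃ c : Fin M → E, (∀ j, c j ∈ Kf ω) ∧ ∀ x ∈ Kf ω, ∃ j, dist x (c j) < δ}
  obtain ⟨M, hM⟩ : ∃ M, P (ZM M) ≠ 0 := by
    by_contra hc
    push Not at hc
    have h1 : P (⋃ M, ZM M) = 0 := measure_iUnion_null hc
    apply hZ
    rw [← nonpos_iff_eq_zero]
    calc P Z ≤ P ((⋃ M, ZM M) ∪ {ω | ¬ Good θ F Kf ω}) := by
          refine measure_mono fun ω hω => ?_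
          rcases Classical.em (Good θ F Kf ω) with hg | hg
          · left
            obtain ⟨t, ht, htf, hcov⟩ := (hK ω).finite_cover_balls hδ
            have := htf.fintype
            obtain ⟨e⟩ : Nonempty (t ≃ Fin (Fintype.card t)) := ⟨Fintype.equivFin t⟩
            refine Set.mem_iUnion.mpr ⟨_, hω, hg, fun j => (e.symm j : E), fun j => ht (e.symm j).2, ?_⟩
            intro x hx
            obtain ⟨z, hz, hxz⟩ := Set.mem_iUnion₂.mp (hcov hx)
            exact ⟨e ⟨z, hz⟩, by simpa using hxz⟩
          · right; exact hg
      _ ≤ P (⋃ M, ZM M) + P {ω | ¬ Good θ F Kf ω} := measure_union_le _ _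
      _ = 0 := by rw [h1, ae_iff.mp hgood, add_zero]
  have hlim : Tendsto (fun L => P ((WF Kf q M L)ᶜ)) atTop (nhds 0) := by
    have h1 := tendsto_measure_iInter_atTop (μ := P) (s := fun L => (WF Kf q M L)ᶜ)
      (fun L => (WF_meas Kf hKm q M L).compl.nullMeasurableSet)
      (fun L L' h => Set.compl_subset_compl.mpr (WF_mono Kf q M h)) ⟨0, measure_ne_top _ _⟩
    rw [← Set.compl_iUnion] at h1
    have h2 : P ((⋃ L, WF Kf q M L)ᶜ) = 0 := ae_iff.mp (hcon M)
    rwa [h2] at h1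
  obtain ⟨L, hLs⟩ := (hlim.eventually (gt_mem_nhds (pos_iff_ne_zero.mpr hM))).exists
  have hexp : Tendsto (fun n : ℕ => 2 * (Real.exp (-(ε * n)) * δ)) atTop (nhds 0) := by
    have h1 : Tendsto (fun n : ℕ => ε * (n : ℝ)) atTop atTop :=
      tendsto_natCast_atTop_atTop.const_mul_atTop hε
    have h2 := ((Real.tendsto_exp_neg_atTop_nhds_zero.comp h1).mul_const δ).const_mul 2
    simpa [Function.comp_def] using h2
  obtain ⟨n, hn⟩ := (hexp.eventually (gt_mem_nhds (show (0 : ℝ) < ((L : ℝ) + 1)⁻¹ by positivity))).exists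
  have hsub : ZM M ⊆ (θ^[k * n]) ⁻¹' ((WF Kf q M L)ᶜ) := by
    rintro ω ⟨hωZ, hg, c, hc, hcov⟩ hW
    obtain ⟨y, hy, hyd⟩ := WF_points Kf hK q M L _ (hg (k * n)).1 hW
    have h1 : ∀ j, ∃ x ∈ Kf ω, fiter θ F (k * n) ω x = y j := by
      intro j
      have := hy j
      rwa [← hg.image] at this
    choose x hx hxy using h1
    choose s hs using fun j => hcov (x j) (hx j)
    obtain ⟨j, j', hjj, hss⟩ := Fintype.exists_ne_map_eq_of_card_lt s (by simp)
    have b1 := bF_contract θ F hF Kf hK r C hC hL q hq N hN k δ ε hε hδ' ω hg hωZ _ _ (hc (s j)) (hs j) n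
    have b2 := bF_contract θ F hF Kf hK r C hC hL q hq N hN k δ ε hε hδ' ω hg hωZ _ _ (hc (s j')) (hs j') n
    rw [← hss] at b2
    have b3 := dist_triangle_right (y j) (y j') (fiter θ F (k * n) ω (c (s j)))
    rw [hxy] at b1 b2
    have := hyd j j' hjj
    linarith
  have h1 := measure_mono (μ := P) hsub
  rw [(hθ.iterate (k * n)).measure_preimage (WF_meas Kf hKm q M L).compl.nullMeasurableSet] at h1
  exact absurd hLs (not_lt.mpr h1)

theorem constancy (P : Measure Ω) [IsProbabilityMeasure P]
    (θ : Ω → Ω) (hθ : Ergodic θ P) (F : Ω → E → E)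
    (Kf : Ω → Set E) (hK : ∀ ω, IsCompact (Kf ω))
    (hKm : ∀ x, Measurable fun ω => infDist x (Kf ω)) (hgood : ∀ᵐ ω ∂P, Good θ F Kf ω)
    (q : ℕ → E) (hq : DenseRange q) (h : ∃ M, ¬ (∀ᵐ ω ∂P, ω ∈ ⋃ L, WF Kf q M L)) :
    ∃ n : ℕ, ∀ᵐ ω ∂P, (Kf ω).Finite ∧ (Kf ω).ncard = n := by
  classical
  have hm : ∀ M, MeasurableSet (⋃ L, WF Kf q M L) := fun M =>
    MeasurableSet.iUnion fun L => WF_meas Kf hKm q M L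
  have hiff : ∀ M, ∀ᵐ ω ∂P, (ω ∈ ⋃ L, WF Kf q M L) ↔ ((M + 1 : ℕ) : ℕ∞) ≤ (Kf ω).encard := by
    intro M
    filter_upwards [hgood] with ω hg
    exact WF_iff Kf hK q hq M ω (hg 0).1
  have h01 : ∀ M, ¬ (∀ᵐ ω ∂P, ω ∈ ⋃ L, WF Kf q M L) → ∀ᵐ ω ∂P, ω ∉ ⋃ L, WF Kf q M L := by
    intro M hM
    have hinv : (⋃ L, WF Kf q M L)ᶜ ≤ᵐ[P] θ ⁻¹' ((⋃ L, WF Kf q M L)ᶜ) := by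
      have h2 := hθ.toMeasurePreserving.quasiMeasurePreserving.ae (hiff M)
      filter_upwards [hgood, hiff M, h2] with ω hg h3 h4
      intro hω hω'
      apply hω
      apply h3.mpr
      refine (h4.mp hω').trans ?_
      have h5 := (hg 0).2
      simp only [Function.iterate_zero, id, zero_add, Function.iterate_one] at h5
      rw [← h5]
      exact Set.encard_image_le _ _
    rcases hθ.ae_empty_or_univ_of_ae_le_preimage (hm M).compl.nullMeasurableSet hinv with h3 | h3
    · exfalso
      apply hM
      have := ae_eq_empty.mp h3
      exact ae_iff.mpr this
    · exact eventuallyEq_univ.mp h3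
  let n := Nat.find h
  have hn := h01 n (Nat.find_spec h)
  refine ⟨n, ?_⟩
  have hlow : ∀ᵐ ω ∂P, ((n : ℕ) : ℕ∞) ≤ (Kf ω).encard := by
    rcases Nat.eq_zero_or_pos n with h0 | h0
    · rw [h0]; simp
    · have h1 := Nat.find_min h (show n - 1 < Nat.find h from Nat.sub_lt h0 one_pos)
      push Not at h1
      filter_upwards [h1, hiff (n - 1)] with ω h2 h3
      have := h3.mp h2
      rwa [Nat.sub_add_cancel h0] at this
  filter_upwards [hn, hiff n, hlow] with ω h1 h2 h3
  have h4 : ¬ ((n + 1 : ℕ) : ℕ∞) ≤ (Kf ω).encard := fun h => h1 (h2.mpr h)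
  have h5 : (Kf ω).encard ≤ n := by
    push Not at h4
    push_cast at h4
    exact Order.lt_add_one_iff_of_not_isMax (by simp) |>.mp h4
  have h6 : (Kf ω).encard = n := le_antisymm h5 h3
  exact ⟨Set.finite_of_encard_eq_coe h6, by rw [Set.ncard, h6]; rfl⟩
end

section
variable {Ω E : Type*} [MeasurableSpace Ω] [NormedAddCommGroup E]
    [InnerProductSpace ℝ E] [FiniteDimensional ℝ E] [MeasurableSpace E] [BorelSpace E]

theorem empty_or_nonempty_ae [Nontrivial E] (P : Measure Ω) [IsProbabilityMeasure P]
    (θ : Ω → Ω) (hθ : Ergodic θ P) (F : Ω → E → E)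
    (Kf : Ω → Set E) (hK : ∀ ω, IsCompact (Kf ω))
    (hKm : ∀ x, Measurable fun ω => infDist x (Kf ω))
    (hinv : ∀ᵐ ω ∂P, F ω '' Kf ω = Kf (θ ω)) :
    (∀ᵐ ω ∂P, Kf ω = ∅) ∨ ∀ᵐ ω ∂P, (Kf ω).Nonempty := by
  have hNC : NoncompactSpace E := NormedSpace.noncompactSpace ℝ E
  have hset : {ω | Kf ω = ∅} = ⋂ i, {ω | infDist (TopologicalSpace.denseSeq E i) (Kf ω) = 0} := by
    ext ω
    simp only [Set.mem_iInter, Set.mem_ofPred_eq]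
    constructor
    · intro h i; rw [h, infDist_empty]
    · intro h
      by_contra hne
      have hne' := Set.nonempty_iff_ne_empty.mpr hne
      have hu : (Kf ω)ᶜ.Nonempty := by
        rw [Set.nonempty_compl]
        exact (hK ω).ne_univ
      obtain ⟨i, hi⟩ := (TopologicalSpace.denseRange_denseSeq E).exists_mem_open (hK ω).isClosed.isOpen_compl hu
      have := ((hK ω).isClosed.notMem_iff_infDist_pos hne').mp hi
      exact this.ne' (h i)
  have hm : MeasurableSet {ω | Kf ω = ∅} := by
    rw [hset]
    exact MeasurableSet.iInter fun i => hKm _ (measurableSet_singleton 0)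
  have hle : {ω | Kf ω = ∅} ≤ᵐ[P] θ ⁻¹' {ω | Kf ω = ∅} := by
    filter_upwards [hinv] with ω h1 h2
    change Kf (θ ω) = ∅
    have h2' : Kf ω = ∅ := h2
    rw [← h1, h2', Set.image_empty]
  rcases hθ.ae_empty_or_univ_of_ae_le_preimage hm.nullMeasurableSet hle with h | h
  · right
    filter_upwards [measure_eq_zero_iff_ae_notMem.mp (ae_eq_empty.mp h)] with ω h1
    exact Set.nonempty_iff_ne_empty.mpr h1
  · left
    exact eventuallyEq_univ.mp h

theorem outer_zero_one (P : Measure Ω) [IsProbabilityMeasure P]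
    (θ : Ω → Ω) (hθ : Ergodic θ P) (A : Set Ω) (hA : ∀ᵐ ω ∂P, ω ∈ A → θ ω ∈ A) :
    P A = 0 ∨ P A = 1 := by
  have hBm := measurableSet_toMeasurable P A
  have hAB := subset_toMeasurable P A
  have hPB := measure_toMeasurable (μ := P) A
  set B := toMeasurable P A
  have hle : B ≤ᵐ[P] θ ⁻¹' B := by
    rw [ae_le_set]
    have h1 := measure_inter_add_diff (μ := P) B (hθ.measurable hBm)
    have h2 : P A ≤ P (B ∩ θ ⁻¹' B) := by
      apply measure_mono_ae
      filter_upwards [hA] with ω h3 h4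
      exact ⟨hAB h4, hAB (h3 h4)⟩
    have h3 : P (B ∩ θ ⁻¹' B) = P B :=
      le_antisymm (measure_mono Set.inter_subset_left) (hPB ▸ h2)
    rw [h3] at h1
    have h4 : P B + P (B \ θ ⁻¹' B) = P B + 0 := by rw [h1, add_zero]
    exact (ENNReal.add_right_inj (measure_ne_top P B)).mp h4
  rw [← hPB]
  rcases hθ.ae_empty_or_univ_of_ae_le_preimage hBm.nullMeasurableSet hle with h | h
  · left; exact ae_eq_empty.mp h
  · right; rw [measure_congr h, measure_univ]

theorem empty_ae_of_subsingleton [Subsingleton E] (P : Measure Ω) [IsProbabilityMeasure P]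
    (θ : Ω → Ω) (hθ : Ergodic θ P) (F : Ω → E → E) (K : Set (Ω × E))
    (hinv : ∀ᵐ ω ∂P, F ω '' {x | (ω, x) ∈ K} = {x | (θ ω, x) ∈ K})
    (hlyap : ∀ μ : Measure (Ω × E),
      IsProbabilityMeasure μ →
      μ.map (fun p : Ω × E => (θ p.1, F p.1 p.2)) = μ →
      μ.map Prod.fst = P → μ K = 1 →
      (⨅ n : ℕ, ((n : ℝ) + 1)⁻¹ *
        ∫ p, Real.log ‖fderiv ℝ (fiter θ F (n + 1) p.1) p.2‖ ∂μ) < 0) :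
    ∀ᵐ ω ∂P, {x | (ω, x) ∈ K} = ∅ := by
  have hA : ∀ᵐ ω ∂P, ω ∈ {ω | (ω, (0 : E)) ∈ K} → θ ω ∈ {ω | (ω, (0 : E)) ∈ K} := by
    filter_upwards [hinv] with ω h1 h2
    have h3 : F ω 0 ∈ {x | (θ ω, x) ∈ K} := by
      rw [← h1]; exact ⟨0, h2, rfl⟩
    rw [Subsingleton.elim (F ω 0) 0] at h3
    exact h3
  rcases outer_zero_one P θ hθ _ hA with h | h
  · filter_upwards [measure_eq_zero_iff_ae_notMem.mp h] with ω h1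
    ext x
    rw [Subsingleton.elim x 0]
    simpa using h1
  · exfalso
    have hs : Measurable fun ω : Ω => (ω, (0 : E)) := measurable_id.prodMk measurable_const
    let e : Ω ≃ᵐ Ω × E :=
      { toFun := fun ω => (ω, 0)
        invFun := Prod.fst
        left_inv := fun _ => rfl
        right_inv := fun p => Prod.ext rfl (Subsingleton.elim _ _)
        measurable_toFun := hs
        measurable_invFun := measurable_fst }
    have hT : (fun p : Ω × E => (θ p.1, F p.1 p.2)) = fun p => (θ p.1, (0 : E)) := by
      funext p; exact Prod.ext rfl (Subsingleton.elim _ _)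
    have hTm : Measurable fun p : Ω × E => (θ p.1, (0 : E)) :=
      (hθ.measurable.comp measurable_fst).prodMk measurable_const
    have := hlyap (P.map e) (Measure.isProbabilityMeasure_map e.measurable.aemeasurable)
      (by
        rw [hT, Measure.map_map hTm e.measurable]
        have : (fun p : Ω × E => (θ p.1, (0 : E))) ∘ e = e ∘ θ := rfl
        rw [this, ← Measure.map_map e.measurable hθ.measurable, hθ.toMeasurePreserving.map_eq])
      (by
        rw [Measure.map_map measurable_fst e.measurable]
        exact Measure.map_id)
      (by
        rw [e.map_apply]; exact h)
    refine absurd this (not_lt.mpr (Real.iInf_nonneg fun n => ?_))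
    refine mul_nonneg (by positivity) (integral_nonneg fun p => ?_)
    have h0 : fderiv ℝ (fiter θ F (n + 1) p.1) p.2 = 0 := by
      ext x; exact Subsingleton.elim _ _
    simp [h0]

theorem main_nonempty (P : Measure Ω) [IsProbabilityMeasure P]
    (θ : Ω → Ω) (herg : Ergodic θ P) (F : Ω → E → E)
    (hFC1 : ∀ ω, ContDiff ℝ 1 (F ω))
    (hFm : ∀ x, Measurable fun ω => F ω x)
    (K : Set (Ω × E))
    (hKc : ∀ ω, IsCompact {x | (ω, x) ∈ K})
    (hKm : ∀ x : E, Measurable fun ω => infDist x {y | (ω, y) ∈ K})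
    (hKinv : ∀ᵐ ω ∂P, F ω '' {x | (ω, x) ∈ K} = {x | (θ ω, x) ∈ K})
    (hne : ∀ᵐ ω ∂P, {x | (ω, x) ∈ K}.Nonempty)
    (r S : ℝ) (hr : 0 < r)
    (hsup : ∀ ω (x : E), infDist x {y | (ω, y) ∈ K} < r →
        Real.log ‖fderiv ℝ (fiter θ F 1 ω) x‖ ≤ S)
    (hlyap : ∀ μ : Measure (Ω × E),
      IsProbabilityMeasure μ →
      μ.map (fun p : Ω × E => (θ p.1, F p.1 p.2)) = μ →
      μ.map Prod.fst = P → μ K = 1 →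
      (⨅ n : ℕ, ((n : ℝ) + 1)⁻¹ *
        ∫ p, Real.log ‖fderiv ℝ (fiter θ F (n + 1) p.1) p.2‖ ∂μ) < 0) :
    ∃ n : ℕ, ∀ᵐ ω ∂P,
      {x | (ω, x) ∈ K}.Finite ∧ {x | (ω, x) ∈ K}.ncard = n := by
  set Kf : Ω → Set E := fun ω => {x | (ω, x) ∈ K} with hKf
  have hq := TopologicalSpace.denseRange_denseSeq E
  set q := TopologicalSpace.denseSeq E
  have hθ := herg.toMeasurePreserving
  have hgood : ∀ᵐ ω ∂P, Good θ F Kf ω := by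
    refine ae_all_iff.mpr fun n => ?_
    have h1 := (hθ.iterate n).quasiMeasurePreserving.ae hne
    have h2 := (hθ.iterate n).quasiMeasurePreserving.ae hKinv
    filter_upwards [h1, h2] with ω h3 h4
    refine ⟨h3, ?_⟩
    rw [Function.iterate_succ_apply']
    exact h4
  have hL : ∀ ω x, infDist x (Kf ω) < r → ‖fderiv ℝ (F ω) x‖ ≤ Real.exp (max S 0) := by
    intro ω x hx
    have h1 := hsup ω x hx
    have h2 : fiter θ F 1 ω = F ω := by funext y; simp [fiter]
    rw [h2] at h1
    rcases (norm_nonneg (fderiv ℝ (F ω) x)).eq_or_lt with h | h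
    · rw [← h]; exact (Real.exp_pos _).le
    · exact (Real.log_le_iff_le_exp h).mp (h1.trans (le_max_left _ _))
  by_cases hcase : ∃ N : ℝ, 0 ≤ N ∧ ∃ k : ℕ, ∃ δ : ℝ, 0 < δ ∧
      δ * Real.exp (max S 0 * k) < r ∧ ∫ ω, bF θ F Kf q (max S 0) N k δ ω ∂P < 0
  · obtain ⟨N, hN, k, δ, hδ, hδ', hneg⟩ := hcase
    exact constancy P θ herg F Kf hKc hKm hgood q hq
      (caseI P θ hθ F hFC1 hFm Kf hKc hKm hgood r (max S 0) (le_max_right _ _) hL q hq N hN k δ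
        hδ hδ' hneg)
  · exfalso
    obtain ⟨μ, hμ, hinv, hfst, hsupp, hlow⟩ := caseII P θ hθ F hFC1 hFm Kf hKc hKm hgood r (max S 0)
      hr (le_max_right _ _) hL q hq (by
        intro N hN k _ δ hδ hδ'
        by_contra h
        exact hcase ⟨N, hN, k, δ, hδ, hδ', not_le.mp h⟩)
    have hK1 : μ K = 1 := by
      have : K =ᵐ[μ] Set.univ := eventuallyEq_univ.mpr hsupp
      rw [measure_congr this, measure_univ]
    refine absurd (hlyap μ hμ hinv hfst hK1) (not_lt.mpr (Real.iInf_nonneg fun n => ?_))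
    exact mul_nonneg (by positivity) (lyap_nonneg θ hθ.measurable F hFC1 hFm (max S 0)
      (le_max_right _ _) μ (n + 1) (Nat.succ_ne_zero n) (hlow (n + 1)))
end


/-- Let `T(ω,x) = (θω, F_ω(x))` be a random `C¹`-map on `Ω × ℝ^d`
with ergodic base and `K` a `T`-invariant random compact set. Suppose that for all
`k ∈ ℕ` and `ε > 0` there is `r > 0` with
`sup {log‖DT^k_ω(x)‖ : ω, x ∈ B_r(K(ω))} ≤ sup {log‖DT^k_ω(x)‖ : ω, x ∈ K(ω)} + ε`,
and `λ(μ,T) < 0` for all `μ ∈ M_P^K(T)`. Then there is `n ∈ ℕ` with `#K(ω) = n`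
for `P`-a.e. `ω`. -/
theorem stmt9 {Ω : Type*} [MeasurableSpace Ω] {d : ℕ}
    (P : Measure Ω) [IsProbabilityMeasure P]
    (θ θinv : Ω → Ω) (hθm : Measurable θ) (hθim : Measurable θinv)
    (hli : Function.LeftInverse θinv θ) (hri : Function.RightInverse θinv θ)
    (herg : Ergodic θ P)
    (F : Ω → EuclideanSpace ℝ (Fin d) → EuclideanSpace ℝ (Fin d))
    (hFC1 : ∀ ω, ContDiff ℝ 1 (F ω))
    (hFm : ∀ x, Measurable fun ω => F ω x)
    (K : Set (Ω × EuclideanSpace ℝ (Fin d)))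
    (hKc : ∀ ω, IsCompact {x | (ω, x) ∈ K})
    (hKm : ∀ x : EuclideanSpace ℝ (Fin d),
      Measurable fun ω => infDist x {y | (ω, y) ∈ K})
    (hKinv : ∀ᵐ ω ∂P, F ω '' {x | (ω, x) ∈ K} = {x | (θ ω, x) ∈ K})
    (hsup : ∀ k : ℕ, ∀ ε > (0 : ℝ), ∃ r > (0 : ℝ),
      ∀ ω (x : EuclideanSpace ℝ (Fin d)), infDist x {y | (ω, y) ∈ K} < r →
        Real.log ‖fderiv ℝ (fiter θ F k ω) x‖ ≤
          (⨆ ω' : Ω, ⨆ y : {y | (ω', y) ∈ K},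
            Real.log ‖fderiv ℝ (fiter θ F k ω') y.1‖) + ε)
    (hlyap : ∀ μ : Measure (Ω × EuclideanSpace ℝ (Fin d)),
      IsProbabilityMeasure μ →
      μ.map (fun p : Ω × EuclideanSpace ℝ (Fin d) => (θ p.1, F p.1 p.2)) = μ →
      μ.map Prod.fst = P → μ K = 1 →
      (⨅ n : ℕ, ((n : ℝ) + 1)⁻¹ *
        ∫ p, Real.log ‖fderiv ℝ (fiter θ F (n + 1) p.1) p.2‖ ∂μ) < 0) :
    ∃ n : ℕ, ∀ᵐ ω ∂P,
      {x | (ω, x) ∈ K}.Finite ∧ {x | (ω, x) ∈ K}.ncard = n := by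
  obtain ⟨r, hr, hS⟩ := hsup 1 1 one_pos
  rcases Nat.eq_zero_or_pos d with h0 | h0
  · subst h0
    have h := empty_ae_of_subsingleton P θ herg F K hKinv hlyap
    refine ⟨0, ?_⟩
    filter_upwards [h] with ω h1
    rw [h1]
    exact ⟨Set.finite_empty, Set.ncard_empty _⟩
  · have : Nonempty (Fin d) := ⟨⟨0, h0⟩⟩
    have : Nontrivial (EuclideanSpace ℝ (Fin d)) := inferInstance
    rcases empty_or_nonempty_ae P θ herg F (fun ω => {x | (ω, x) ∈ K}) hKc hKm hKinv with h | h
    · refine ⟨0, ?_⟩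
      filter_upwards [h] with ω h1
      rw [h1]
      exact ⟨Set.finite_empty, Set.ncard_empty _⟩
    · exact main_nonempty P θ herg F hFC1 hFm K hKc hKm hKinv h r _ hr hS hlyap
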